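/- Let p ≥ 3 be an integer and let S be a distribution on Γ whose support is contained in the perfect symmetric set E_{1/p} of constant ratio 1/p. If Ŝ(n) → 0 as n → +∞, then S = 0. -/

import Mathlib

noncomputable section

/-- An invertible contraction on a (complex) Banach space. -/
structure BanachContraction where
  X : Type
  [grp : NormedAddCommGroup X]
  [mod : NormedSpace ℂ X]
  [cpl : CompleteSpace X]
  T : X →L[ℂ] X
  Tinv : X →L[ℂ] X
  norm_le : ‖T‖ ≤ 1
  mul_inv : T * Tinv = 1
  inv_mul : Tinv * T = 1

attribute [instance] BanachContraction.grp BanachContraction.mod BanachContraction.cpl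

open Complex MeasureTheory Metric Set Filter

/-- The `n`-th Taylor coefficient of `f` at `0`, i.e. `f⁽ⁿ⁾(0)/n!`. -/
def taylorCoeff (f : ℂ → ℂ) (n : ℕ) : ℂ := iteratedDeriv n f 0 / (n.factorial : ℂ)

/-- `A⁺`, the algebra of absolutely convergent Taylor series: functions which, on the
closed unit disk, are sums of a power series with absolutely summable coefficients. -/
def APlus : Set (ℂ → ℂ) :=
  {f | ∃ a : ℕ → ℂ, Summable (fun n => ‖a n‖) ∧
    ∀ z ∈ Metric.closedBall (0 : ℂ) 1, HasSum (fun n => a n * z ^ n) (f z)}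

/-- The norm `‖f‖₁ = ∑ₙ |f⁽ⁿ⁾(0)/n!|` on `A⁺`. -/
def APlusNorm (f : ℂ → ℂ) : ℝ := ∑' n : ℕ, ‖taylorCoeff f n‖

/-- The `n`-th Fourier coefficient of (the boundary values of) `f` on the unit circle. -/
def fcoeff (f : ℂ → ℂ) (n : ℤ) : ℂ :=
  (1 / (2 * Real.pi)) * ∫ θ in (0:ℝ)..(2 * Real.pi),
    f (Complex.exp ((θ : ℂ) * Complex.I)) * Complex.exp (-(n : ℂ) * (θ : ℂ) * Complex.I)

/-- The Wiener algebra `A(Γ)` of absolutely convergent Fourier series on the unit circle,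
viewed as functions `ℂ → ℂ` (only the values on the unit circle are relevant). -/
def WienerAlg : Set (ℂ → ℂ) :=
  {f | Summable (fun n : ℤ => ‖fcoeff f n‖) ∧
    ∀ z ∈ Metric.sphere (0 : ℂ) 1, HasSum (fun n : ℤ => fcoeff f n * z ^ n) (f z)}

/-- The norm `‖f‖₁ = ∑_{n ∈ ℤ} |f̂(n)|` on `A(Γ)`. -/
def WienerNorm (f : ℂ → ℂ) : ℝ := ∑' n : ℤ, ‖fcoeff f n‖

/-- `I` is a closed ideal of `A⁺` (closedness w.r.t. the norm `APlusNorm`). -/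
def IsClosedIdealAPlus (I : Set (ℂ → ℂ)) : Prop :=
  I ⊆ APlus ∧
  (∀ f ∈ I, ∀ g ∈ I, f + g ∈ I) ∧
  (∀ f ∈ APlus, ∀ g ∈ I, f * g ∈ I) ∧
  (∀ f ∈ APlus, (∀ ε > 0, ∃ g ∈ I, APlusNorm (f - g) < ε) → f ∈ I)

/-- `J` is a closed ideal of the Wiener algebra `A(Γ)`. -/
def IsClosedIdealW (J : Set (ℂ → ℂ)) : Prop :=
  J ⊆ WienerAlg ∧
  (∀ f ∈ J, ∀ g ∈ J, f + g ∈ J) ∧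
  (∀ f ∈ WienerAlg, ∀ g ∈ J, f * g ∈ J) ∧
  (∀ f ∈ WienerAlg, (∀ ε > 0, ∃ g ∈ J, WienerNorm (f - g) < ε) → f ∈ J)

/-- `I^A` : the closed ideal generated by `I` in the Wiener algebra `A(Γ)`. -/
def IdealGenW (I : Set (ℂ → ℂ)) : Set (ℂ → ℂ) := ⋂₀ {J | IsClosedIdealW J ∧ I ⊆ J}

/-- The hull `h(I)`: common zeros in the closed unit disk of all elements of `I`. -/
def hull (I : Set (ℂ → ℂ)) : Set ℂ :=
  {z ∈ Metric.closedBall (0 : ℂ) 1 | ∀ f ∈ I, f z = 0}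

/-- `I ≠ {0}`: `I` contains an element not identically zero on the unit disk. -/
def NontrivialIdeal (I : Set (ℂ → ℂ)) : Prop :=
  ∃ f ∈ I, ∃ z ∈ Metric.ball (0 : ℂ) 1, f z ≠ 0

/-- `H^∞(D)`: bounded holomorphic functions on the open unit disk. -/
def Hinf : Set (ℂ → ℂ) :=
  {f | DifferentiableOn ℂ f (Metric.ball (0 : ℂ) 1) ∧
    ∃ C : ℝ, ∀ z ∈ Metric.ball (0 : ℂ) 1, ‖f z‖ ≤ C}

/-- An inner function: a bounded-by-one holomorphic function on the unit disk whose
radial limits have modulus `1` at almost every boundary point. -/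
def IsInnerFunction (u : ℂ → ℂ) : Prop :=
  DifferentiableOn ℂ u (Metric.ball (0 : ℂ) 1) ∧
  (∀ z ∈ Metric.ball (0 : ℂ) 1, ‖u z‖ ≤ 1) ∧
  ∀ᵐ (θ : ℝ) ∂(MeasureTheory.volume.restrict (Set.Ioc (0 : ℝ) (2 * Real.pi))),
    Filter.Tendsto (fun r : ℝ => ‖u ((r : ℂ) * Complex.exp ((θ : ℂ) * Complex.I))‖)
      (nhdsWithin 1 (Set.Iio 1)) (nhds 1)

/-- `S` divides (the inner factor of) `f`, i.e. `f ∈ S·H^∞`. -/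
def InnerDivides (S f : ℂ → ℂ) : Prop :=
  ∃ g ∈ Hinf, ∀ z ∈ Metric.ball (0 : ℂ) 1, f z = S z * g z

/-- `S` is a greatest common divisor of the inner factors of the nonzero elements of `I`:
`S` is inner, divides every nonzero element of `I`, and every inner function with this
property divides `S`. -/
def IsGcdInner (I : Set (ℂ → ℂ)) (S : ℂ → ℂ) : Prop :=
  IsInnerFunction S ∧
  (∀ f ∈ I, (∃ z ∈ Metric.ball (0 : ℂ) 1, f z ≠ 0) → InnerDivides S f) ∧
  ∀ S' : ℂ → ℂ, IsInnerFunction S' →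
    (∀ f ∈ I, (∃ z ∈ Metric.ball (0 : ℂ) 1, f z ≠ 0) → InnerDivides S' f) →
    InnerDivides S' S

/-- The perfect symmetric set `E_ξ` of constant ratio `ξ` on the unit circle. -/
def Eset (ξ : ℝ) : Set ℂ :=
  {z | ∃ ε : ℕ → ℕ, (∀ k, ε k ≤ 1) ∧
    z = Complex.exp (2 * Real.pi * Complex.I *
      (((1 - ξ) * ∑' k : ℕ, (ε k : ℝ) * ξ ^ k : ℝ) : ℂ))}

/-- A Carleson set: a closed subset of the unit circle with
`∫_{-π}^{π} log (2 / dist(e^{iθ}, E)) dθ < ∞`. -/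
def IsCarleson (E : Set ℂ) : Prop :=
  IsClosed E ∧ E ⊆ Metric.sphere (0 : ℂ) 1 ∧
  MeasureTheory.IntegrableOn
    (fun θ : ℝ => Real.log (2 / Metric.infDist (Complex.exp ((θ : ℂ) * Complex.I)) E))
    (Set.Ioc (-Real.pi) Real.pi)

/-- The division ideal `I(f) = {g ∈ A⁺ : fg ∈ I}`. -/
def Idiv (I : Set (ℂ → ℂ)) (f : ℂ → ℂ) : Set (ℂ → ℂ) := {g ∈ APlus | f * g ∈ I}

/-- `f` belongs to `A^∞(D)` and vanishes on `E` together with all its derivatives: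
`f` is holomorphic on the disk, and each derivative extends continuously to the closed
disk with the extension vanishing on `E`. -/
def VanishAllDeriv (E : Set ℂ) (f : ℂ → ℂ) : Prop :=
  ContinuousOn f (Metric.closedBall (0 : ℂ) 1) ∧
  DifferentiableOn ℂ f (Metric.ball (0 : ℂ) 1) ∧
  (∀ z ∈ E, f z = 0) ∧
  ∀ n : ℕ, ∃ g : ℂ → ℂ, ContinuousOn g (Metric.closedBall (0 : ℂ) 1) ∧
    Set.EqOn g (iteratedDeriv n f) (Metric.ball (0 : ℂ) 1) ∧ ∀ z ∈ E, g z = 0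

/-- `J₀⁺(E)`: the closure in `A⁺` of the set of elements of `A^∞(D)` vanishing on `E`
together with all their derivatives. -/
def J0Plus (E : Set ℂ) : Set (ℂ → ℂ) :=
  {f | f ∈ APlus ∧ ∀ ε > 0, ∃ g ∈ APlus, VanishAllDeriv E g ∧ APlusNorm (f - g) < ε}

/-- `I⁺(E) = {f ∈ A⁺ : f ≡ 0 on E}`. -/
def IPlus (E : Set ℂ) : Set (ℂ → ℂ) := {f ∈ APlus | ∀ z ∈ E, f z = 0}

/-- The pairing of `f ∈ A⁺ ≅ ℓ¹(ℕ)` with an element `c ∈ c₀`. -/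
def pairing (f : ℂ → ℂ) (c : ℕ → ℂ) : ℂ := ∑' n : ℕ, taylorCoeff f n * c n

/-- `S` is dense in `A⁺` for the weak-star topology `σ(ℓ¹, c₀)`. -/
def WStarDense (S : Set (ℂ → ℂ)) : Prop :=
  ∀ f ∈ APlus, ∀ (m : ℕ) (c : Fin m → ℕ → ℂ),
    (∀ i, Filter.Tendsto (c i) Filter.atTop (nhds 0)) →
    ∀ ε > 0, ∃ g ∈ S, ∀ i, ‖pairing f (c i) - pairing g (c i)‖ < ε

/-- `S` is closed in `A⁺` for the weak-star topology `σ(ℓ¹, c₀)`. -/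
def WStarClosed (S : Set (ℂ → ℂ)) : Prop :=
  S ⊆ APlus ∧
  ∀ f ∈ APlus,
    (∀ (m : ℕ) (c : Fin m → ℕ → ℂ),
      (∀ i, Filter.Tendsto (c i) Filter.atTop (nhds 0)) →
      ∀ ε > 0, ∃ g ∈ S, ∀ i, ‖pairing f (c i) - pairing g (c i)‖ < ε) → f ∈ S

/-- A Kronecker set: a compact subset of the unit circle on which every continuous
unimodular function is a uniform limit of characters `z ↦ zⁿ`, `n ∈ ℤ`. -/
def IsKronecker (K : Set ℂ) : Prop :=
  IsCompact K ∧ K ⊆ Metric.sphere (0 : ℂ) 1 ∧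
  ∀ f : ℂ → ℂ, ContinuousOn f K → (∀ z ∈ K, ‖f z‖ = 1) →
    ∀ ε > 0, ∃ n : ℤ, ∀ z ∈ K, ‖f z - z ^ n‖ < ε

/-- A Helson set: a compact subset of the unit circle on which every continuous function
is the restriction of an element of the Wiener algebra. -/
def IsHelson (K : Set ℂ) : Prop :=
  IsCompact K ∧ K ⊆ Metric.sphere (0 : ℂ) 1 ∧
  ∀ f : ℂ → ℂ, ContinuousOn f K → ∃ g ∈ WienerAlg, ∀ z ∈ K, f z = g z

/-- The little Lipschitz class `Λ_α(D)`: disc-algebra functions with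
`|f(e^{it₁}) - f(e^{it₂})| / |t₁-t₂|^α → 0` uniformly as `|t₁-t₂| → 0`. -/
def LittleLip (α : ℝ) (f : ℂ → ℂ) : Prop :=
  ContinuousOn f (Metric.closedBall (0 : ℂ) 1) ∧
  DifferentiableOn ℂ f (Metric.ball (0 : ℂ) 1) ∧
  ∀ ε > 0, ∃ δ > 0, ∀ t₁ t₂ : ℝ, t₁ ≠ t₂ → |t₁ - t₂| < δ →
    ‖f (Complex.exp ((t₁ : ℂ) * Complex.I)) - f (Complex.exp ((t₂ : ℂ) * Complex.I))‖ ≤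
      ε * |t₁ - t₂| ^ α

/-- The perfect part of a set: the union of all its perfect subsets. -/
def perfectPart (C : Set ℂ) : Set ℂ := ⋃₀ {P | Perfect P ∧ P ⊆ C}

/-- A distribution on the unit circle, encoded by its sequence of Fourier coefficients
`μ̂(n) = μ(e^{-int})`, which has polynomial growth. -/
structure CircleDistribution where
  coeff : ℤ → ℂ
  growth : ∃ (C : ℝ) (k : ℕ), ∀ n : ℤ, ‖coeff n‖ ≤ C * (1 + (n.natAbs : ℝ)) ^ k

/-- A smooth `2π`-periodic function (test function on the circle). -/
def PeriodicSmooth (φ : ℝ → ℂ) : Prop :=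
  ContDiff ℝ (⊤ : ℕ∞) φ ∧ ∀ θ : ℝ, φ (θ + 2 * Real.pi) = φ θ

/-- Fourier coefficients of a test function. -/
def testCoeff (φ : ℝ → ℂ) (n : ℤ) : ℂ :=
  (1 / (2 * Real.pi)) * ∫ θ in (0:ℝ)..(2 * Real.pi),
    φ θ * Complex.exp (-(n : ℂ) * (θ : ℂ) * Complex.I)

/-- The action of a distribution on a test function: `μ(φ) = ∑ₙ μ̂(n) φ̂(-n)`. -/
def distAct (μ : CircleDistribution) (φ : ℝ → ℂ) : ℂ := ∑' n : ℤ, μ.coeff n * testCoeff φ (-n)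

/-- The support of a distribution on the circle: the points of the circle having no open
neighbourhood `U` such that `μ` kills every test function supported in `U`. -/
def distSupport (μ : CircleDistribution) : Set ℂ :=
  {z ∈ Metric.sphere (0 : ℂ) 1 | ∀ U : Set ℂ, IsOpen U → z ∈ U →
    ∃ φ : ℝ → ℂ, PeriodicSmooth φ ∧
      (∀ θ : ℝ, Complex.exp ((θ : ℂ) * Complex.I) ∉ U → φ θ = 0) ∧ distAct μ φ ≠ 0}

/-- A set of multiplicity: a closed subset of the circle supporting a nonzero
pseudofunction (distribution whose Fourier coefficients tend to `0` as `|n| → ∞`). -/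
def IsMSet (E : Set ℂ) : Prop :=
  IsClosed E ∧ E ⊆ Metric.sphere (0 : ℂ) 1 ∧
  ∃ μ : CircleDistribution, μ.coeff ≠ 0 ∧ distSupport μ ⊆ E ∧
    Filter.Tendsto μ.coeff Filter.cofinite (nhds 0)

/-- A Dirichlet set: `sup_{z ∈ E} |z^{n_k} - 1| → 0` for some sequence `n_k → ∞`. -/
def IsDirichletSet (E : Set ℂ) : Prop :=
  ∃ n : ℕ → ℕ, Filter.Tendsto n Filter.atTop Filter.atTop ∧
    ∀ ε > 0, ∀ᶠ k in Filter.atTop, ∀ z ∈ E, ‖z ^ (n k) - 1‖ < ε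

open scoped ContDiff

lemma norm_iteratedDeriv_mul_le_sum {f g : ℝ → ℂ} (hf : ContDiff ℝ ∞ f) (hg : ContDiff ℝ ∞ g)
    (n : ℕ) (x : ℝ) :
    ‖iteratedDeriv n (fun t => f t * g t) x‖ ≤ ∑ i ∈ Finset.range (n + 1),
      (n.choose i : ℝ) * ‖iteratedDeriv i f x‖ * ‖iteratedDeriv (n - i) g x‖ := by
  have h := norm_iteratedFDeriv_mul_le hf hg x (n := n) (by exact_mod_cast le_top)
  simpa only [norm_iteratedFDeriv_eq_norm_iteratedDeriv] using h

lemma norm_iteratedDeriv_mul_le_geom {f g : ℝ → ℂ} (hf : ContDiff ℝ ∞ f) (hg : ContDiff ℝ ∞ g)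
    {n : ℕ} {x a b D : ℝ} (hD : 0 ≤ D) (ha : ∀ i ≤ n, ‖iteratedDeriv i f x‖ ≤ a * D ^ i)
    (hb : ∀ i ≤ n, ‖iteratedDeriv i g x‖ ≤ b * D ^ i) :
    ∀ i ≤ n, ‖iteratedDeriv i (fun t => f t * g t) x‖ ≤ a * b * (2 * D) ^ i := by
  intro i hi
  have ha0 : 0 ≤ a := by simpa using (norm_nonneg _).trans (ha 0 (Nat.zero_le _))
  refine (norm_iteratedDeriv_mul_le_sum hf hg i x).trans ?_
  have key : ∀ l ∈ Finset.range (i + 1),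
      (i.choose l : ℝ) * ‖iteratedDeriv l f x‖ * ‖iteratedDeriv (i - l) g x‖ ≤
        (i.choose l : ℝ) * (a * b * D ^ i) := by
    intro l hl
    have hl' : l ≤ i := Nat.lt_succ_iff.mp (Finset.mem_range.mp hl)
    calc _ ≤ (i.choose l : ℝ) * (a * D ^ l) * (b * D ^ (i - l)) := by
          gcongr
          · exact ha l (hl'.trans hi)
          · exact hb _ ((Nat.sub_le _ _).trans hi)
      _ = (i.choose l : ℝ) * (a * b * (D ^ l * D ^ (i - l))) := by ring
      _ = _ := by rw [← pow_add, Nat.add_sub_cancel' hl']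
  refine (Finset.sum_le_sum key).trans ?_
  rw [← Finset.sum_mul, ← Nat.cast_sum, Nat.sum_range_choose, mul_pow]
  push_cast
  exact le_of_eq (by ring)

lemma norm_iteratedDeriv_le_of_riccati {y : ℝ → ℂ} (hy : ContDiff ℝ ∞ y) {c a : ℂ} {q R : ℝ}
    (hc : ‖c‖ ≤ q) (ha : ‖a‖ ≤ 2) (hR : 1 ≤ R)
    (hderiv : deriv y = fun t => c * (y t - a * (y t * y t))) {x : ℝ} (hx : ‖y x‖ ≤ R) (n : ℕ) :
    ‖iteratedDeriv n y x‖ ≤ n.factorial * (3 * q) ^ n * R ^ (n + 1) := by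
  have hq : 0 ≤ q := (norm_nonneg c).trans hc
  induction n using Nat.strong_induction_on with
  | _ n ih =>
    rcases n with _ | n
    · simpa using hx
    have hyy : ContDiff ℝ ∞ (fun t => y t * y t) := hy.mul hy
    have hn : ((n : ℕ) : WithTop ℕ∞) ≤ ∞ := by exact_mod_cast le_top
    have h1 : iteratedDeriv (n + 1) y x =
        c * (iteratedDeriv n y x - a * iteratedDeriv n (fun t => y t * y t) x) := by
      rw [iteratedDeriv_succ', hderiv, iteratedDeriv_const_mul_field,
        iteratedDeriv_fun_sub (hy.of_le hn).contDiffAt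
          ((contDiff_const.mul hyy).of_le hn).contDiffAt, iteratedDeriv_const_mul_field]
    have h2 : ‖iteratedDeriv n (fun t => y t * y t) x‖ ≤
        (n + 1) * (n.factorial * (3 * q) ^ n * R ^ (n + 2)) := by
      refine (norm_iteratedDeriv_mul_le_sum hy hy n x).trans ?_
      have key : ∀ l ∈ Finset.range (n + 1),
          (n.choose l : ℝ) * ‖iteratedDeriv l y x‖ * ‖iteratedDeriv (n - l) y x‖ ≤
            n.factorial * (3 * q) ^ n * R ^ (n + 2) := by
        intro l hl
        have hl' : l ≤ n := Nat.lt_succ_iff.mp (Finset.mem_range.mp hl)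
        have hf : (n.choose l : ℝ) * l.factorial * (n - l).factorial = n.factorial := by
          exact_mod_cast Nat.choose_mul_factorial_mul_factorial hl'
        calc _ ≤ (n.choose l : ℝ) * (l.factorial * (3 * q) ^ l * R ^ (l + 1)) *
                ((n - l).factorial * (3 * q) ^ (n - l) * R ^ (n - l + 1)) := by
              gcongr
              · exact ih l (by omega)
              · exact ih (n - l) (by omega)
          _ = ((n.choose l : ℝ) * l.factorial * (n - l).factorial) *
                ((3 * q) ^ l * (3 * q) ^ (n - l)) * (R ^ (l + 1) * R ^ (n - l + 1)) := by ring
          _ = _ := by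
              rw [hf, ← pow_add, ← pow_add, Nat.add_sub_cancel' hl']
              congr 2; omega
      refine (Finset.sum_le_sum key).trans ?_
      simp
    have h3 : ‖iteratedDeriv n y x‖ ≤ n.factorial * (3 * q) ^ n * R ^ (n + 2) := by
      refine (ih n (by omega)).trans ?_
      exact mul_le_mul_of_nonneg_left (pow_le_pow_right₀ hR (by omega)) (by positivity)
    rw [h1, norm_mul]
    set A : ℝ := n.factorial * (3 * q) ^ n * R ^ (n + 2) with hA
    have hA0 : 0 ≤ A := by positivity
    calc _ ≤ q * (A + 2 * ((n + 1) * A)) := by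
          gcongr
          refine (norm_sub_le _ _).trans ?_
          rw [norm_mul]
          gcongr
      _ ≤ q * (3 * ((n + 1) * A)) := by
          gcongr
          have : (0 : ℝ) ≤ n * A := by positivity
          nlinarith
      _ = _ := by
          rw [hA, Nat.factorial_succ]; push_cast; ring

lemma norm_iteratedDeriv_le_of_logDeriv {F G : ℝ → ℂ} (hF : ContDiff ℝ ∞ F)
    (hG : ContDiff ℝ ∞ G) (hderiv : deriv F = fun t => G t * F t) {x Q : ℝ} (hQ : 0 ≤ Q) {n : ℕ}
    (hGx : ∀ i < n, ‖iteratedDeriv i G x‖ ≤ Q ^ (i + 1)) :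
    ∀ i ≤ n, ‖iteratedDeriv i F x‖ ≤ i.factorial * ‖F x‖ * Q ^ i := by
  intro i
  induction i using Nat.strong_induction_on with
  | _ i ih =>
    intro hi
    rcases i with _ | i
    · simp
    rw [iteratedDeriv_succ', hderiv]
    refine (norm_iteratedDeriv_mul_le_sum hG hF i x).trans ?_
    have key : ∀ l ∈ Finset.range (i + 1),
        (i.choose l : ℝ) * ‖iteratedDeriv l G x‖ * ‖iteratedDeriv (i - l) F x‖ ≤
          i.factorial * ‖F x‖ * Q ^ (i + 1) := by
      intro l hl
      have hl' : l ≤ i := Nat.lt_succ_iff.mp (Finset.mem_range.mp hl)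
      have hf : (i.choose l : ℝ) * (i - l).factorial ≤ i.factorial := by
        rw [← Nat.choose_mul_factorial_mul_factorial hl']
        push_cast
        have : (1 : ℝ) ≤ l.factorial := by exact_mod_cast Nat.factorial_pos l
        have h0 : (0 : ℝ) ≤ (i.choose l : ℝ) * (i - l).factorial := by positivity
        nlinarith
      calc _ ≤ (i.choose l : ℝ) * Q ^ (l + 1) * ((i - l).factorial * ‖F x‖ * Q ^ (i - l)) := by
            gcongr
            · exact hGx l (by omega)
            · exact ih (i - l) (by omega) (by omega)
        _ = ((i.choose l : ℝ) * (i - l).factorial) * ‖F x‖ * (Q ^ (l + 1) * Q ^ (i - l)) := by ring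
        _ ≤ i.factorial * ‖F x‖ * (Q ^ (l + 1) * Q ^ (i - l)) := by gcongr
        _ = _ := by
            rw [← pow_add]; congr 2; omega
    refine (Finset.sum_le_sum key).trans ?_
    rw [Finset.sum_const, Finset.card_range, nsmul_eq_mul, Nat.factorial_succ]
    push_cast
    exact le_of_eq (by ring)

lemma exists_bound_iteratedDeriv_smoothTransition (n : ℕ) :
    ∃ K : ℝ, 0 ≤ K ∧ ∀ i ≤ n, ∀ t : ℝ,
      ‖iteratedDeriv i (fun s => (Real.smoothTransition s : ℂ)) t‖ ≤ K := by
  have hsm : ContDiff ℝ ∞ (fun s => (Real.smoothTransition s : ℂ)) :=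
    Complex.ofRealCLM.contDiff.comp Real.smoothTransition.contDiff
  have hzero : ∀ s ∉ Set.Icc (0 : ℝ) 1,
      deriv (fun s => (Real.smoothTransition s : ℂ)) s = 0 := by
    intro s hs
    rw [Set.mem_Icc, not_and_or, not_le, not_le] at hs
    rcases hs with hs | hs
    · have : (fun s => (Real.smoothTransition s : ℂ)) =ᶠ[nhds s] fun _ => 0 := by
        filter_upwards [Iio_mem_nhds hs] with r hr
        simp [Real.smoothTransition.zero_of_nonpos (le_of_lt hr)]
      rw [this.deriv_eq]; simp
    · have : (fun s => (Real.smoothTransition s : ℂ)) =ᶠ[nhds s] fun _ => 1 := by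
        filter_upwards [Ioi_mem_nhds hs] with r hr
        simp [Real.smoothTransition.one_of_one_le (le_of_lt hr)]
      rw [this.deriv_eq]; simp
  have hc : HasCompactSupport (deriv (fun s => (Real.smoothTransition s : ℂ))) :=
    HasCompactSupport.intro isCompact_Icc hzero
  have hbd : ∀ i : ℕ, ∃ K : ℝ, ∀ t : ℝ,
      ‖iteratedDeriv i (fun s => (Real.smoothTransition s : ℂ)) t‖ ≤ K := by
    intro i
    rcases i with _ | i
    · refine ⟨1, fun t => ?_⟩
      rw [iteratedDeriv_zero, Complex.norm_real, Real.norm_eq_abs,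
        abs_of_nonneg (Real.smoothTransition.nonneg t)]
      exact Real.smoothTransition.le_one t
    · obtain ⟨K, hK⟩ := (hc.iteratedFDeriv (𝕜 := ℝ) i).exists_bound_of_continuous
        (((contDiff_infty_iff_deriv.mp hsm).2).continuous_iteratedFDeriv
          (by exact_mod_cast le_top))
      refine ⟨K, fun t => ?_⟩
      rw [iteratedDeriv_succ', ← norm_iteratedFDeriv_eq_norm_iteratedDeriv]
      exact hK t
  choose K hK using hbd
  have hK0 : ∀ i, 0 ≤ K i := fun i => (norm_nonneg _).trans (hK i 0)
  refine ⟨∑ i ∈ Finset.range (n + 1), K i, Finset.sum_nonneg fun i _ => hK0 i, fun i hi t => ?_⟩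
  exact (hK i t).trans (Finset.single_le_sum (f := K) (fun i _ => hK0 i)
    (Finset.mem_range.mpr (by omega)))

lemma hasDerivAt_exp_mul_I (c : ℂ) (t : ℝ) :
    HasDerivAt (fun s : ℝ => Complex.exp (c * (s : ℂ) * Complex.I))
      (c * Complex.I * Complex.exp (c * (t : ℂ) * Complex.I)) t := by
  have h : HasDerivAt (fun s : ℝ => c * (s : ℂ) * Complex.I) (c * Complex.I) t := by
    simpa using ((Complex.ofRealCLM.hasDerivAt (x := t)).const_mul c).mul_const Complex.I
  simpa [mul_comm] using h.cexp

lemma exp_int_mul_add_two_pi (n : ℤ) (t : ℝ) :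
    Complex.exp (-(n : ℂ) * ((t + 2 * Real.pi : ℝ) : ℂ) * Complex.I) =
      Complex.exp (-(n : ℂ) * (t : ℂ) * Complex.I) := by
  rw [Complex.exp_eq_exp_iff_exists_int]
  exact ⟨-n, by push_cast; ring⟩

lemma norm_exp_int_mul (n : ℤ) (t : ℝ) :
    ‖Complex.exp (-(n : ℂ) * (t : ℂ) * Complex.I)‖ = 1 := by
  have := Complex.norm_exp_ofReal_mul_I (-(n : ℝ) * t)
  simpa using this

lemma PeriodicSmooth.deriv {φ : ℝ → ℂ} (h : PeriodicSmooth φ) : PeriodicSmooth (deriv φ) := by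
  refine ⟨(contDiff_infty_iff_deriv.mp h.1).2, fun θ => ?_⟩
  rw [← deriv_comp_add_const]
  congr 1
  exact funext h.2

lemma PeriodicSmooth.iteratedDeriv {φ : ℝ → ℂ} (h : PeriodicSmooth φ) (n : ℕ) :
    PeriodicSmooth (iteratedDeriv n φ) := by
  induction n with
  | zero => simpa using h
  | succ n ih => rw [iteratedDeriv_succ]; exact ih.deriv

lemma PeriodicSmooth.add {φ ψ : ℝ → ℂ} (h : PeriodicSmooth φ) (h' : PeriodicSmooth ψ) :
    PeriodicSmooth (fun t => φ t + ψ t) :=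
  ⟨h.1.add h'.1, fun θ => by simp only [h.2, h'.2]⟩

lemma PeriodicSmooth.mul {φ ψ : ℝ → ℂ} (h : PeriodicSmooth φ) (h' : PeriodicSmooth ψ) :
    PeriodicSmooth (fun t => φ t * ψ t) :=
  ⟨h.1.mul h'.1, fun θ => by simp only [h.2, h'.2]⟩

lemma contDiff_exp_mul_I (c : ℂ) :
    ContDiff ℝ ∞ (fun s : ℝ => Complex.exp (c * (s : ℂ) * Complex.I)) :=
  ((contDiff_const.mul Complex.ofRealCLM.contDiff).mul contDiff_const).cexp

lemma testCoeff_deriv {φ : ℝ → ℂ} (h : PeriodicSmooth φ) (n : ℤ) :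
    testCoeff (deriv φ) n = (n : ℂ) * Complex.I * testCoeff φ n := by
  have hc := contDiff_exp_mul_I (-(n : ℂ))
  have hd := h.deriv.1.continuous
  have key := intervalIntegral.integral_mul_deriv_eq_deriv_mul (a := 0) (b := 2 * Real.pi)
    (u := fun s : ℝ => Complex.exp (-(n : ℂ) * (s : ℂ) * Complex.I)) (v := φ)
    (u' := fun s : ℝ => -(n : ℂ) * Complex.I * Complex.exp (-(n : ℂ) * (s : ℂ) * Complex.I))
    (v' := deriv φ) (fun x _ => hasDerivAt_exp_mul_I _ x)
    (fun x _ => ((h.1.differentiable (by simp)) x).hasDerivAt)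
    ((continuous_const.mul hc.continuous).intervalIntegrable _ _) (hd.intervalIntegrable _ _)
  have h0 := exp_int_mul_add_two_pi n 0
  have h1 := h.2 0
  rw [zero_add] at h0 h1
  rw [h0, h1, sub_self, zero_sub] at key
  unfold testCoeff
  simp only [mul_comm (deriv φ _), mul_comm (φ _)]
  have h2 : ∀ x : ℝ, -(n : ℂ) * Complex.I * Complex.exp (-(n : ℂ) * (x : ℂ) * Complex.I) * φ x =
      -((n : ℂ) * Complex.I) * (Complex.exp (-(n : ℂ) * (x : ℂ) * Complex.I) * φ x) := by
    intro x; ring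
  simp only [h2] at key
  rw [key, intervalIntegral.integral_const_mul]
  ring

lemma testCoeff_iteratedDeriv {φ : ℝ → ℂ} (h : PeriodicSmooth φ) (s : ℕ) (n : ℤ) :
    testCoeff (iteratedDeriv s φ) n = ((n : ℂ) * Complex.I) ^ s * testCoeff φ n := by
  induction s with
  | zero => simp
  | succ s ih => rw [iteratedDeriv_succ, testCoeff_deriv (h.iteratedDeriv s), ih]; ring

lemma norm_testCoeff_le {φ : ℝ → ℂ} {B : ℝ} (hB : ∀ t, ‖φ t‖ ≤ B) (n : ℤ) :
    ‖testCoeff φ n‖ ≤ B := by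
  unfold testCoeff
  have h := intervalIntegral.norm_integral_le_of_norm_le_const (a := 0) (b := 2 * Real.pi)
    (f := fun θ : ℝ => φ θ * Complex.exp (-(n : ℂ) * (θ : ℂ) * Complex.I)) (C := B)
    (fun x _ => by rw [norm_mul, norm_exp_int_mul, mul_one]; exact hB x)
  have hpi := Real.pi_pos
  rw [sub_zero, abs_of_pos (by positivity)] at h
  rw [norm_mul]
  have h2 : ‖(1 / (2 * Real.pi) : ℂ)‖ = 1 / (2 * Real.pi) := by
    simp [abs_of_pos hpi]
  rw [h2]
  calc _ ≤ 1 / (2 * Real.pi) * (B * (2 * Real.pi)) := by gcongr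
    _ = B := by field_simp

lemma PeriodicSmooth.norm_testCoeff_mul_pow_le {φ : ℝ → ℂ} (h : PeriodicSmooth φ) {s : ℕ}
    {B : ℝ} (hB : ∀ t, ‖_root_.iteratedDeriv s φ t‖ ≤ B) (n : ℤ) :
    ‖testCoeff φ n‖ * |(n : ℝ)| ^ s ≤ B := by
  have := norm_testCoeff_le hB n
  rw [testCoeff_iteratedDeriv h, norm_mul, norm_pow, norm_mul, Complex.norm_I, mul_one,
    Complex.norm_intCast] at this
  linarith

lemma PeriodicSmooth.exists_bound {φ : ℝ → ℂ} (h : PeriodicSmooth φ) :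
    ∃ B, ∀ t, ‖φ t‖ ≤ B := by
  have hp : Function.Periodic φ (2 * Real.pi) := h.2
  have hb := hp.isBounded_of_continuous (by positivity) h.1.continuous
  obtain ⟨B, hB⟩ := hb.exists_norm_le
  exact ⟨B, fun t => hB _ ⟨t, rfl⟩⟩

lemma summable_one_div_one_add_abs_sq :
    Summable (fun l : ℤ => 1 / (1 + |(l : ℝ)|) ^ 2) := by
  refine Summable.of_norm_bounded_eventually (g := fun l : ℤ => 1 / (l : ℝ) ^ 2)
    (Real.summable_one_div_int_pow.mpr one_lt_two) ?_
  have : {0}ᶜ ∈ (cofinite : Filter ℤ) := (Set.finite_singleton 0).compl_mem_cofinite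
  filter_upwards [this] with l hl
  have hl' : (l : ℝ) ≠ 0 := by exact_mod_cast hl
  rw [Real.norm_of_nonneg (by positivity)]
  apply one_div_le_one_div_of_le (by positivity)
  rw [← sq_abs]
  gcongr
  linarith [abs_nonneg (l : ℝ)]

lemma norm_coeff_mul_testCoeff_le (S : CircleDistribution) {C : ℝ} {k : ℕ} (hC : 0 ≤ C)
    (hS : ∀ n : ℤ, ‖S.coeff n‖ ≤ C * (1 + (n.natAbs : ℝ)) ^ k) {φ : ℝ → ℂ}
    (h : PeriodicSmooth φ) {B : ℝ} (h0 : ∀ t, ‖φ t‖ ≤ B)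
    (h1 : ∀ t, ‖iteratedDeriv (k + 2) φ t‖ ≤ B) (l : ℤ) :
    ‖S.coeff l * testCoeff φ (-l)‖ ≤ C * 2 ^ (k + 3) * B * (1 / (1 + |(l : ℝ)|) ^ 2) := by
  have hB : 0 ≤ B := (norm_nonneg _).trans (h0 0)
  have a0 := norm_testCoeff_le h0 (-l)
  have a1 := h.norm_testCoeff_mul_pow_le h1 (-l)
  have hl := hS l
  have hnat : (l.natAbs : ℝ) = |(l : ℝ)| := by
    rw [Nat.cast_natAbs, Int.cast_abs]
  rw [hnat] at hl
  rw [Int.cast_neg, abs_neg] at a1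
  set x : ℝ := |(l : ℝ)| with hx
  have hx0 : 0 ≤ x := abs_nonneg _
  set y : ℝ := ‖testCoeff φ (-l)‖ with hy
  have hy0 : 0 ≤ y := norm_nonneg _
  have hpow : (1 + x) ^ (k + 2) ≤ 2 ^ (k + 2) * (1 + x ^ (k + 2)) := by
    have hm : 1 + x ≤ 2 * max 1 x := by
      linarith [le_max_left 1 x, le_max_right 1 x]
    calc (1 + x) ^ (k + 2) ≤ (2 * max 1 x) ^ (k + 2) := by gcongr
      _ = 2 ^ (k + 2) * (max 1 x) ^ (k + 2) := by rw [mul_pow]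
      _ ≤ _ := by
        gcongr
        rcases le_total 1 x with hc | hc
        · rw [max_eq_right hc]; linarith
        · rw [max_eq_left hc, one_pow]; linarith [pow_nonneg hx0 (k + 2)]
  rw [norm_mul, mul_one_div, le_div_iff₀ (by positivity)]
  calc ‖S.coeff l‖ * y * (1 + x) ^ 2 ≤ (C * (1 + x) ^ k) * y * (1 + x) ^ 2 := by gcongr
    _ = C * (y * (1 + x) ^ (k + 2)) := by ring
    _ ≤ C * (y * (2 ^ (k + 2) * (1 + x ^ (k + 2)))) := by gcongr
    _ = C * 2 ^ (k + 2) * (y + y * x ^ (k + 2)) := by ring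
    _ ≤ C * 2 ^ (k + 2) * (B + B) := by gcongr
    _ = _ := by ring

lemma CircleDistribution.exists_growth (S : CircleDistribution) :
    ∃ (C : ℝ) (k : ℕ), 0 ≤ C ∧ ∀ n : ℤ, ‖S.coeff n‖ ≤ C * (1 + (n.natAbs : ℝ)) ^ k := by
  obtain ⟨C, k, h⟩ := S.growth
  refine ⟨C, k, ?_, h⟩
  have := (norm_nonneg _).trans (h 0)
  simpa using this

lemma summable_distAct (S : CircleDistribution) {φ : ℝ → ℂ} (h : PeriodicSmooth φ) :
    Summable (fun n : ℤ => S.coeff n * testCoeff φ (-n)) := by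
  obtain ⟨C, k, hC, hS⟩ := S.exists_growth
  obtain ⟨B0, hB0⟩ := h.exists_bound
  obtain ⟨B1, hB1⟩ := (h.iteratedDeriv (k + 2)).exists_bound
  exact Summable.of_norm_bounded
    (summable_one_div_one_add_abs_sq.mul_left (C * 2 ^ (k + 3) * max B0 B1))
    (norm_coeff_mul_testCoeff_le S hC hS h (fun t => (hB0 t).trans (le_max_left _ _))
      (fun t => (hB1 t).trans (le_max_right _ _)))

lemma exists_norm_distAct_le (S : CircleDistribution) :
    ∃ (C : ℝ) (k : ℕ), 0 ≤ C ∧ ∀ (φ : ℝ → ℂ) (B : ℝ), PeriodicSmooth φ → (∀ t, ‖φ t‖ ≤ B) →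
      (∀ t, ‖iteratedDeriv k φ t‖ ≤ B) → ‖distAct S φ‖ ≤ C * B := by
  obtain ⟨C, k, hC, hS⟩ := S.exists_growth
  refine ⟨C * 2 ^ (k + 3) * ∑' l : ℤ, 1 / (1 + |(l : ℝ)|) ^ 2, k + 2, ?_, ?_⟩
  · exact mul_nonneg (by positivity) (tsum_nonneg fun l => by positivity)
  · intro φ B h h0 h1
    have := tsum_of_norm_bounded
      (summable_one_div_one_add_abs_sq.mul_left (C * 2 ^ (k + 3) * B)).hasSum
      (norm_coeff_mul_testCoeff_le S hC hS h h0 h1)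
    rw [tsum_mul_left] at this
    unfold distAct
    linarith

lemma testCoeff_add {φ ψ : ℝ → ℂ} (h : Continuous φ) (h' : Continuous ψ) (n : ℤ) :
    testCoeff (fun t => φ t + ψ t) n = testCoeff φ n + testCoeff ψ n := by
  unfold testCoeff
  have hc := (contDiff_exp_mul_I (-(n : ℂ))).continuous
  have key := intervalIntegral.integral_add (μ := volume)
    ((h.mul hc).intervalIntegrable 0 (2 * Real.pi)) ((h'.mul hc).intervalIntegrable 0 (2 * Real.pi))
  simp only [Pi.mul_apply] at key
  rw [← mul_add, ← key]
  simp only [add_mul]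

lemma distAct_add (S : CircleDistribution) {φ ψ : ℝ → ℂ} (h : PeriodicSmooth φ)
    (h' : PeriodicSmooth ψ) : distAct S (fun t => φ t + ψ t) = distAct S φ + distAct S ψ := by
  unfold distAct
  rw [← (summable_distAct S h).tsum_add (summable_distAct S h')]
  simp only [testCoeff_add h.1.continuous h'.1.continuous, mul_add]

lemma distAct_zero (S : CircleDistribution) : distAct S (fun _ => 0) = 0 := by
  simp [distAct, testCoeff]

lemma distAct_sum_eq_zero (S : CircleDistribution) {ι : Type*} (s : Finset ι) (φ : ι → ℝ → ℂ)
    (h : ∀ i ∈ s, PeriodicSmooth (φ i)) (h0 : ∀ i ∈ s, distAct S (φ i) = 0) :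
    PeriodicSmooth (fun t => ∑ i ∈ s, φ i t) ∧ distAct S (fun t => ∑ i ∈ s, φ i t) = 0 := by
  classical
  induction s using Finset.induction_on with
  | empty => exact ⟨⟨by simpa using contDiff_const, by simp⟩, by simpa using distAct_zero S⟩
  | insert a s ha ih =>
    obtain ⟨h1, h2⟩ := ih (fun i hi => h i (Finset.mem_insert_of_mem hi))
      (fun i hi => h0 i (Finset.mem_insert_of_mem hi))
    simp only [Finset.sum_insert ha]
    refine ⟨(h a (Finset.mem_insert_self _ _)).add h1, ?_⟩
    rw [distAct_add S (h a (Finset.mem_insert_self _ _)) h1, h2,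
      h0 a (Finset.mem_insert_self _ _), add_zero]

lemma testCoeff_exp (k l : ℤ) :
    testCoeff (fun t : ℝ => Complex.exp (-(k : ℂ) * (t : ℂ) * Complex.I)) l =
      if k = -l then 1 else 0 := by
  have hpi : (Real.pi : ℂ) ≠ 0 := by exact_mod_cast Real.pi_ne_zero
  unfold testCoeff
  have h1 : ∀ t : ℝ, Complex.exp (-(k : ℂ) * (t : ℂ) * Complex.I) *
      Complex.exp (-(l : ℂ) * (t : ℂ) * Complex.I) =
      Complex.exp (-((k : ℂ) + l) * Complex.I * t) := by
    intro t; rw [← Complex.exp_add]; congr 1; ring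
  simp only [h1]
  split_ifs with h
  · subst h
    simp
    field_simp
  · have hc : -((k : ℂ) + l) * Complex.I ≠ 0 := by
      refine mul_ne_zero (neg_ne_zero.mpr ?_) Complex.I_ne_zero
      exact_mod_cast fun hh => h (by omega)
    rw [integral_exp_mul_complex hc]
    have h2 := exp_int_mul_add_two_pi (k + l) 0
    have h3 : -((k : ℂ) + l) * Complex.I * ((2 * Real.pi : ℝ) : ℂ) =
        -((k + l : ℤ) : ℂ) * ((0 + 2 * Real.pi : ℝ) : ℂ) * Complex.I := by push_cast; ring
    rw [h3, h2]
    simp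

lemma testCoeff_tsum_exp {b : ℕ → ℂ} (hb : Summable (fun n => ‖b n‖)) (k : ℕ → ℤ) (l : ℤ) :
    testCoeff (fun t : ℝ => ∑' n, b n * Complex.exp (-(k n : ℂ) * (t : ℂ) * Complex.I)) l =
      ∑' n, b n * if k n = -l then 1 else 0 := by
  have key := intervalIntegral.hasSum_integral_of_dominated_convergence (a := 0)
    (b := 2 * Real.pi) (μ := volume)
    (F := fun n (t : ℝ) => b n * Complex.exp (-(k n : ℂ) * (t : ℂ) * Complex.I) *
      Complex.exp (-(l : ℂ) * (t : ℂ) * Complex.I))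
    (f := fun t : ℝ => (∑' n, b n * Complex.exp (-(k n : ℂ) * (t : ℂ) * Complex.I)) *
      Complex.exp (-(l : ℂ) * (t : ℂ) * Complex.I))
    (fun n _ => ‖b n‖)
    (fun n => ((continuous_const.mul (contDiff_exp_mul_I _).continuous).mul
      (contDiff_exp_mul_I _).continuous).aestronglyMeasurable)
    (fun n => .of_forall fun t _ => by simp only [norm_mul, norm_exp_int_mul, mul_one, le_refl])
    (.of_forall fun t _ => hb) (by simp)
    (.of_forall fun t _ => HasSum.mul_right _ (Summable.hasSum (Summable.of_norm
      (by simpa only [norm_mul, norm_exp_int_mul, mul_one] using hb))))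
  unfold testCoeff
  rw [← key.tsum_eq, ← tsum_mul_left]
  congr 1
  ext n
  rw [← testCoeff_exp]
  unfold testCoeff
  simp only [mul_assoc (b n)]
  rw [intervalIntegral.integral_const_mul]
  ring

lemma distAct_tsum_exp (S : CircleDistribution) {b : ℕ → ℂ} (hb : Summable (fun n => ‖b n‖))
    {k : ℕ → ℤ} (hk : Function.Injective k) :
    distAct S (fun t : ℝ => ∑' n, b n * Complex.exp (-(k n : ℂ) * (t : ℂ) * Complex.I)) =
      ∑' n, b n * S.coeff (k n) := by
  unfold distAct
  simp only [testCoeff_tsum_exp hb, neg_neg]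
  rw [← hk.tsum_eq]
  · congr 1
    ext n
    rw [tsum_eq_single n]
    · simp [mul_comm]
    · intro j hj
      rw [if_neg (fun h => hj (hk h)), mul_zero]
  · intro l hl
    by_contra hr
    refine hl ?_
    have : ∀ n, b n * (if k n = l then 1 else 0) = 0 := fun n => by
      rw [if_neg (fun h => hr ⟨n, h⟩), mul_zero]
    simp [this]

lemma PeriodicSmooth.comp_exp {g : ℂ → ℂ} (hg : ContDiff ℝ ∞ g) :
    PeriodicSmooth (fun t : ℝ => g (Complex.exp ((t : ℂ) * Complex.I))) := by
  refine ⟨hg.comp (Complex.ofRealCLM.contDiff.mul contDiff_const).cexp, fun θ => ?_⟩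
  have h : Complex.exp (((θ + 2 * Real.pi : ℝ) : ℂ) * Complex.I) =
      Complex.exp ((θ : ℂ) * Complex.I) := by
    rw [Complex.exp_eq_exp_iff_exists_int]
    exact ⟨1, by push_cast; ring⟩
  simp only [h]

/-- A distribution kills every test function vanishing near its support. -/
lemma distAct_eq_zero_of_vanish_near (S : CircleDistribution) {E : Set ℂ} (hE : distSupport S ⊆ E)
    {φ : ℝ → ℂ} (h : PeriodicSmooth φ)
    (h0 : ∀ z ∈ E, ∃ U, IsOpen U ∧ z ∈ U ∧
      ∀ θ : ℝ, Complex.exp ((θ : ℂ) * Complex.I) ∈ U → φ θ = 0) : distAct S φ = 0 := by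
  have hloc : ∀ z : ℂ, ∃ U : Set ℂ, IsOpen U ∧ (z ∈ Metric.sphere (0 : ℂ) 1 → z ∈ U) ∧
      ∀ ρ : ℝ → ℂ, PeriodicSmooth ρ →
        (∀ θ : ℝ, Complex.exp ((θ : ℂ) * Complex.I) ∉ U → ρ θ = 0) →
        distAct S (fun t => ρ t * φ t) = 0 := by
    intro z
    by_cases hz : z ∈ E
    · obtain ⟨U, hU, hzU, hφ⟩ := h0 z hz
      refine ⟨U, hU, fun _ => hzU, fun ρ _ hρ => ?_⟩
      have : (fun t => ρ t * φ t) = fun _ => 0 := by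
        ext t
        by_cases ht : Complex.exp ((t : ℂ) * Complex.I) ∈ U
        · rw [hφ t ht, mul_zero]
        · rw [hρ t ht, zero_mul]
      rw [this, distAct_zero]
    · by_cases hzs : z ∈ Metric.sphere (0 : ℂ) 1
      · have hns : z ∉ distSupport S := fun hh => hz (hE hh)
        simp only [distSupport, Set.mem_ofPred_eq, not_and, not_forall] at hns
        obtain ⟨U, hU, hzU, hno⟩ := hns hzs
        refine ⟨U, hU, fun _ => hzU, fun ρ hρ hρ0 => ?_⟩
        by_contra hne
        exact hno ⟨_, hρ.mul h, fun θ hθ => by rw [hρ0 θ hθ, zero_mul], hne⟩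
      · refine ⟨∅, isOpen_empty, fun hh => absurd hh hzs, fun ρ _ hρ => ?_⟩
        have : (fun t => ρ t * φ t) = fun _ => 0 := by
          ext t; rw [hρ t (Set.notMem_empty _), zero_mul]
        rw [this, distAct_zero]
  choose U hUo hUz hUρ using hloc
  obtain ⟨t, ht⟩ := (isCompact_sphere (0 : ℂ) 1).elim_finite_subcover U hUo
    (fun z hz => Set.mem_iUnion.mpr ⟨z, hUz z hz⟩)
  obtain ⟨f, hf⟩ := SmoothPartitionOfUnity.exists_isSubordinate (modelWithCornersSelf ℝ ℂ)
    (s := Metric.sphere (0 : ℂ) 1) Metric.isClosed_sphere (fun i : t => U i) (fun i => hUo i)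
    (by simpa [Set.iUnion_subtype] using ht)
  have hsm : ∀ i : t, PeriodicSmooth
      (fun s : ℝ => ((f i (Complex.exp ((s : ℂ) * Complex.I)) : ℝ) : ℂ)) := fun i =>
    PeriodicSmooth.comp_exp (g := fun z => ((f i z : ℝ) : ℂ))
      (Complex.ofRealCLM.contDiff.comp (f i).contMDiff.contDiff)
  have hsum := (distAct_sum_eq_zero S Finset.univ
    (fun (i : t) (s : ℝ) => ((f i (Complex.exp ((s : ℂ) * Complex.I)) : ℝ) : ℂ) * φ s)
    (fun i _ => (hsm i).mul h)
    (fun i _ => hUρ i _ (hsm i) (fun θ hθ => by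
      have : f i (Complex.exp ((θ : ℂ) * Complex.I)) = 0 := by
        by_contra hne
        exact hθ (hf i (subset_tsupport _ hne))
      simp [this]))).2
  convert hsum using 2
  ext s
  have h1 := f.sum_eq_one (x := Complex.exp ((s : ℂ) * Complex.I))
    (by simp [Complex.norm_exp_ofReal_mul_I])
  rw [finsum_eq_sum_of_fintype] at h1
  rw [← Finset.sum_mul, ← Complex.ofReal_sum, h1]
  simp

/-- A finite sum of Cauchy kernels with poles at the points `(1 + δ j) / ζ j`, of masses `δ j`. -/
def cauchySum {ι : Type*} (J : Finset ι) (δ : ι → ℝ) (ζ : ι → ℂ) (w : ℂ) : ℂ :=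
  ∑ j ∈ J, (δ j : ℂ) * (1 + (δ j : ℂ) - ζ j * w)⁻¹

lemma le_re_one_add_sub {δ : ℝ} {ζ w : ℂ} (hζ : ‖ζ‖ = 1) (hw : ‖w‖ ≤ 1) :
    δ ≤ (1 + (δ : ℂ) - ζ * w).re := by
  have h : (ζ * w).re ≤ 1 := (Complex.re_le_norm _).trans (by rw [norm_mul, hζ, one_mul]; exact hw)
  simp only [Complex.sub_re, Complex.add_re, Complex.one_re, Complex.ofReal_re]
  linarith

lemma one_add_sub_ne_zero {δ : ℝ} {ζ w : ℂ} (hδ : 0 < δ) (hζ : ‖ζ‖ = 1) (hw : ‖w‖ ≤ 1) :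
    1 + (δ : ℂ) - ζ * w ≠ 0 := by
  intro h
  have := le_re_one_add_sub (δ := δ) hζ hw
  rw [h, Complex.zero_re] at this
  linarith

lemma le_norm_one_add_sub {δ : ℝ} {ζ w : ℂ} (hζ : ‖ζ‖ = 1) (hw : ‖w‖ ≤ 1) :
    δ ≤ ‖1 + (δ : ℂ) - ζ * w‖ :=
  (le_re_one_add_sub hζ hw).trans (Complex.re_le_norm _)

lemma norm_one_sub_le_norm_one_add_sub {δ : ℝ} {ζ w : ℂ} (hδ : 0 ≤ δ) (hζ : ‖ζ‖ = 1)
    (hw : ‖w‖ ≤ 1) : ‖1 - ζ * w‖ ≤ ‖1 + (δ : ℂ) - ζ * w‖ := by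
  have h := le_re_one_add_sub (δ := 0) hζ hw
  simp only [Complex.ofReal_zero, add_zero] at h
  have h1 : 1 + (δ : ℂ) - ζ * w = (1 - ζ * w) + δ := by ring
  rw [h1, Complex.norm_def, Complex.norm_def]
  apply Real.sqrt_le_sqrt
  rw [Complex.normSq_apply, Complex.normSq_apply]
  simp only [Complex.add_re, Complex.add_im, Complex.ofReal_re, Complex.ofReal_im, add_zero]
  nlinarith

lemma re_mul_inv_nonneg {δ : ℝ} {ζ w : ℂ} (hδ : 0 ≤ δ) (hζ : ‖ζ‖ = 1) (hw : ‖w‖ ≤ 1) :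
    0 ≤ ((δ : ℂ) * (1 + (δ : ℂ) - ζ * w)⁻¹).re := by
  rw [Complex.re_ofReal_mul, Complex.inv_re]
  have := le_re_one_add_sub (δ := δ) hζ hw
  exact mul_nonneg hδ (div_nonneg (hδ.trans this) (Complex.normSq_nonneg _))

lemma one_div_hundred_le_re_mul_inv {δ : ℝ} {ζ w : ℂ} (hδ : 0 < δ) (hζ : ‖ζ‖ = 1) (hw : ‖w‖ ≤ 1)
    (h : ‖1 - ζ * w‖ ≤ 9 * δ) : 1 / 100 ≤ ((δ : ℂ) * (1 + (δ : ℂ) - ζ * w)⁻¹).re := by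
  have h1 := le_re_one_add_sub (δ := δ) hζ hw
  have h2 := le_norm_one_add_sub (δ := δ) hζ hw
  have h3 : ‖1 + (δ : ℂ) - ζ * w‖ ≤ 10 * δ := by
    have : 1 + (δ : ℂ) - ζ * w = (1 - ζ * w) + δ := by ring
    rw [this]
    refine (norm_add_le _ _).trans ?_
    rw [Complex.norm_real, Real.norm_of_nonneg hδ.le]
    linarith
  rw [Complex.re_ofReal_mul, Complex.inv_re, Complex.normSq_eq_norm_sq, mul_div_assoc',
    div_le_div_iff₀ (by norm_num) (pow_pos (hδ.trans_le h2) 2)]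
  nlinarith

section CauchySum

variable {ι : Type*} {J : Finset ι} {δ : ι → ℝ} {ζ : ι → ℂ}

lemma le_re_cauchySum_of_subset {J' : Finset ι} (hδ : ∀ j ∈ J, 0 < δ j) (hζ : ∀ j ∈ J, ‖ζ j‖ = 1)
    {w : ℂ} (hw : ‖w‖ ≤ 1) (hJ : J' ⊆ J) (h : ∀ j ∈ J', ‖1 - ζ j * w‖ ≤ 9 * δ j) :
    (J'.card : ℝ) / 100 ≤ (cauchySum J δ ζ w).re := by
  unfold cauchySum
  rw [Complex.re_sum]
  calc (J'.card : ℝ) / 100 = ∑ j ∈ J', (1 / 100 : ℝ) := by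
        rw [Finset.sum_const, nsmul_eq_mul]; ring
    _ ≤ ∑ j ∈ J', ((δ j : ℂ) * (1 + (δ j : ℂ) - ζ j * w)⁻¹).re :=
        Finset.sum_le_sum fun j hj =>
          one_div_hundred_le_re_mul_inv (hδ j (hJ hj)) (hζ j (hJ hj)) hw (h j hj)
    _ ≤ _ := Finset.sum_le_sum_of_subset_of_nonneg hJ fun j hj _ =>
          re_mul_inv_nonneg (hδ j hj).le (hζ j hj) hw

lemma contDiff_inv_exp {q : ℤ} {d : ℝ} {z : ℂ} (hd : 0 < d) (hz : ‖z‖ = 1) :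
    ContDiff ℝ ∞ (fun t : ℝ =>
      (1 + (d : ℂ) - z * Complex.exp (-(q : ℂ) * (t : ℂ) * Complex.I))⁻¹) :=
  (contDiff_const.sub (contDiff_const.mul (contDiff_exp_mul_I _))).inv
    (fun t => one_add_sub_ne_zero hd hz (norm_exp_int_mul q t).le)

lemma deriv_inv_exp {q : ℤ} {d : ℝ} {z : ℂ} (hd : 0 < d) (hz : ‖z‖ = 1) :
    deriv (fun t : ℝ => (1 + (d : ℂ) - z * Complex.exp (-(q : ℂ) * (t : ℂ) * Complex.I))⁻¹) =
      fun t : ℝ => ((q : ℂ) * Complex.I) *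
        ((1 + (d : ℂ) - z * Complex.exp (-(q : ℂ) * (t : ℂ) * Complex.I))⁻¹ - (1 + (d : ℂ)) *
        ((1 + (d : ℂ) - z * Complex.exp (-(q : ℂ) * (t : ℂ) * Complex.I))⁻¹ *
        (1 + (d : ℂ) - z * Complex.exp (-(q : ℂ) * (t : ℂ) * Complex.I))⁻¹)) := by
  ext t
  have hne := one_add_sub_ne_zero hd hz (norm_exp_int_mul q t).le
  have h := (((hasDerivAt_exp_mul_I (-(q : ℂ)) t).const_mul z).const_sub (1 + (d : ℂ))).inv hne
  have h' := h.deriv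
  refine Eq.trans ?_ (h'.trans ?_)
  · rfl
  · field_simp
    ring

lemma contDiff_cauchySum (q : ℤ) (hδ : ∀ j ∈ J, 0 < δ j) (hζ : ∀ j ∈ J, ‖ζ j‖ = 1) :
    ContDiff ℝ ∞ (fun t : ℝ =>
      cauchySum J δ ζ (Complex.exp (-(q : ℂ) * (t : ℂ) * Complex.I))) :=
  ContDiff.sum fun j hj => contDiff_const.mul (contDiff_inv_exp (hδ j hj) (hζ j hj))

lemma norm_iteratedDeriv_cauchySum_le {q : ℤ} (hq : 1 ≤ q) (hδ : ∀ j ∈ J, 0 < δ j)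
    (hδ1 : ∀ j ∈ J, δ j ≤ 1) (hζ : ∀ j ∈ J, ‖ζ j‖ = 1) (hmass : ∑ j ∈ J, δ j ≤ 3) {R : ℝ}
    (hR : 1 ≤ R) {x : ℝ} (hx : ∀ j ∈ J,
      ‖(1 + (δ j : ℂ) - ζ j * Complex.exp (-(q : ℂ) * (x : ℂ) * Complex.I))⁻¹‖ ≤ R) (n : ℕ) :
    ‖iteratedDeriv n (fun t : ℝ =>
      cauchySum J δ ζ (Complex.exp (-(q : ℂ) * (t : ℂ) * Complex.I))) x‖ ≤
      3 * (n.factorial * (3 * q) ^ n * R ^ (n + 1)) := by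
  have hq' : (1 : ℝ) ≤ q := by exact_mod_cast hq
  have hn : ((n : ℕ) : WithTop ℕ∞) ≤ ∞ := by exact_mod_cast le_top
  unfold cauchySum
  rw [iteratedDeriv_fun_sum (fun j hj => ((contDiff_const.mul
    (contDiff_inv_exp (hδ j hj) (hζ j hj))).of_le hn).contDiffAt)]
  refine (norm_sum_le _ _).trans ?_
  calc _ ≤ ∑ j ∈ J, δ j * (n.factorial * (3 * q) ^ n * R ^ (n + 1)) := by
        refine Finset.sum_le_sum fun j hj => ?_
        rw [iteratedDeriv_const_mul_field, norm_mul, Complex.norm_real,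
          Real.norm_of_nonneg (hδ j hj).le]
        refine mul_le_mul_of_nonneg_left ?_ (hδ j hj).le
        refine norm_iteratedDeriv_le_of_riccati (contDiff_inv_exp (hδ j hj) (hζ j hj)) ?_ ?_ hR
          (deriv_inv_exp (hδ j hj) (hζ j hj)) (hx j hj) n
        · rw [norm_mul, Complex.norm_I, mul_one, Complex.norm_intCast, abs_of_nonneg (by linarith)]
        · have : (1 : ℂ) + (δ j : ℂ) = ((1 + δ j : ℝ) : ℂ) := by push_cast; rfl
          rw [this, Complex.norm_real, Real.norm_of_nonneg (by linarith [hδ j hj])]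
          linarith [hδ1 j hj]
    _ ≤ _ := by
        rw [← Finset.sum_mul]
        gcongr

lemma norm_iteratedDeriv_cauchySum_le_pow {q : ℤ} (hq : 1 ≤ q) (hδ : ∀ j ∈ J, 0 < δ j)
    (hδ1 : ∀ j ∈ J, δ j ≤ 1) (hζ : ∀ j ∈ J, ‖ζ j‖ = 1) (hmass : ∑ j ∈ J, δ j ≤ 3) {R : ℝ}
    (hR : 1 ≤ R) {x : ℝ} (hx : ∀ j ∈ J,
      ‖(1 + (δ j : ℂ) - ζ j * Complex.exp (-(q : ℂ) * (x : ℂ) * Complex.I))⁻¹‖ ≤ R)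
    {C : ℝ} (hC : 1 ≤ C) {s i : ℕ} (hi : 1 ≤ i) (his : i ≤ s) :
    C * ‖iteratedDeriv i (fun t : ℝ =>
      cauchySum J δ ζ (Complex.exp (-(q : ℂ) * (t : ℂ) * Complex.I))) x‖ ≤
      (9 * C * q * s.factorial * R ^ 2) ^ i := by
  have hq' : (1 : ℝ) ≤ q := by exact_mod_cast hq
  have hs : (1 : ℝ) ≤ s.factorial := by exact_mod_cast Nat.factorial_pos s
  have hfac : (i.factorial : ℝ) ≤ s.factorial := by exact_mod_cast Nat.factorial_le his
  have hpow : ∀ {a : ℝ}, 1 ≤ a → a ≤ a ^ i := fun ha => le_self_pow₀ ha (by omega)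
  calc _ ≤ C * (3 * (i.factorial * (3 * q) ^ i * R ^ (i + 1))) := by
        gcongr
        exact norm_iteratedDeriv_cauchySum_le hq hδ hδ1 hζ hmass hR hx i
    _ ≤ C ^ i * (3 ^ i * ((s.factorial : ℝ) ^ i * (3 * q) ^ i * (R ^ 2) ^ i)) := by
        gcongr
        · exact hpow hC
        · exact hpow (by norm_num)
        · exact hfac.trans (hpow hs)
        · rw [← pow_mul]
          exact pow_le_pow_right₀ hR (by omega)
    _ = _ := by rw [← mul_pow, ← mul_pow, ← mul_pow, ← mul_pow]; congr 1; ring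

lemma contDiff_exp_cauchySum (q : ℤ) (hδ : ∀ j ∈ J, 0 < δ j) (hζ : ∀ j ∈ J, ‖ζ j‖ = 1) (C : ℝ) :
    ContDiff ℝ ∞ (fun t : ℝ => Complex.exp (-(C : ℂ) *
      cauchySum J δ ζ (Complex.exp (-(q : ℂ) * (t : ℂ) * Complex.I)))) :=
  (contDiff_const.mul (contDiff_cauchySum q hδ hζ)).cexp

lemma norm_iteratedDeriv_exp_cauchySum_le {q : ℤ} (hq : 1 ≤ q) (hδ : ∀ j ∈ J, 0 < δ j)
    (hδ1 : ∀ j ∈ J, δ j ≤ 1) (hζ : ∀ j ∈ J, ‖ζ j‖ = 1) (hmass : ∑ j ∈ J, δ j ≤ 3) {R : ℝ}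
    (hR : 1 ≤ R) {x : ℝ} (hx : ∀ j ∈ J,
      ‖(1 + (δ j : ℂ) - ζ j * Complex.exp (-(q : ℂ) * (x : ℂ) * Complex.I))⁻¹‖ ≤ R)
    {C : ℝ} (hC : 1 ≤ C) {s i : ℕ} (his : i ≤ s) :
    ‖iteratedDeriv i (fun t : ℝ => Complex.exp (-(C : ℂ) *
      cauchySum J δ ζ (Complex.exp (-(q : ℂ) * (t : ℂ) * Complex.I)))) x‖ ≤
      i.factorial * Real.exp (-C * (cauchySum J δ ζ
        (Complex.exp (-(q : ℂ) * (x : ℂ) * Complex.I))).re) *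
      (9 * C * q * s.factorial * R ^ 2) ^ i := by
  have hh := contDiff_cauchySum q hδ hζ
  have hh' := (contDiff_infty_iff_deriv.mp hh).2
  have hq' : (1 : ℝ) ≤ q := by exact_mod_cast hq
  have := norm_iteratedDeriv_le_of_logDeriv (contDiff_exp_cauchySum q hδ hζ C)
    (G := fun t => -(C : ℂ) * deriv (fun t : ℝ =>
      cauchySum J δ ζ (Complex.exp (-(q : ℂ) * (t : ℂ) * Complex.I))) t)
    (contDiff_const.mul hh') (by
      ext t
      have h1 := ((hh.differentiable (by simp)) t).hasDerivAt
      rw [((h1.const_mul (-(C : ℂ))).cexp).deriv]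
      ring) (x := x) (Q := 9 * C * q * s.factorial * R ^ 2) (by positivity) (n := s) (by
      intro l hl
      rw [iteratedDeriv_const_mul_field, ← iteratedDeriv_succ', norm_mul, norm_neg,
        Complex.norm_real, Real.norm_of_nonneg (by linarith)]
      exact norm_iteratedDeriv_cauchySum_le_pow hq hδ hδ1 hζ hmass hR hx hC (by omega) (by omega))
    i his
  rw [Complex.norm_exp] at this
  convert this using 4
  simp

/-- The cutoff equal to `1` where the real part of the Cauchy sum is at least `L + 1`, and to `0`
where it is at most `L`. -/
def cutoff {ι : Type*} (J : Finset ι) (δ : ι → ℝ) (ζ : ι → ℂ) (L : ℝ) (w : ℂ) : ℂ :=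
  (Real.smoothTransition ((cauchySum J δ ζ w).re - L) : ℂ)

lemma contDiff_re_cauchySum_sub (q : ℤ) (hδ : ∀ j ∈ J, 0 < δ j) (hζ : ∀ j ∈ J, ‖ζ j‖ = 1) (L : ℝ) :
    ContDiff ℝ ∞ (fun t : ℝ =>
      (cauchySum J δ ζ (Complex.exp (-(q : ℂ) * (t : ℂ) * Complex.I))).re - L) :=
  (Complex.reCLM.contDiff.comp (contDiff_cauchySum q hδ hζ)).sub contDiff_const

lemma contDiff_cutoff (q : ℤ) (hδ : ∀ j ∈ J, 0 < δ j) (hζ : ∀ j ∈ J, ‖ζ j‖ = 1) (L : ℝ) :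
    ContDiff ℝ ∞ (fun t : ℝ => cutoff J δ ζ L (Complex.exp (-(q : ℂ) * (t : ℂ) * Complex.I))) :=
  Complex.ofRealCLM.contDiff.comp
    (Real.smoothTransition.contDiff.comp (contDiff_re_cauchySum_sub q hδ hζ L))

lemma norm_iteratedDeriv_cutoff_le {q : ℤ} (hq : 1 ≤ q) (hδ : ∀ j ∈ J, 0 < δ j)
    (hδ1 : ∀ j ∈ J, δ j ≤ 1) (hζ : ∀ j ∈ J, ‖ζ j‖ = 1) (hmass : ∑ j ∈ J, δ j ≤ 3) {R : ℝ}
    (hR : 1 ≤ R) {x : ℝ} (hx : ∀ j ∈ J,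
      ‖(1 + (δ j : ℂ) - ζ j * Complex.exp (-(q : ℂ) * (x : ℂ) * Complex.I))⁻¹‖ ≤ R)
    {s : ℕ} {K : ℝ} (hK : ∀ i ≤ s, ∀ t : ℝ,
      ‖iteratedDeriv i (fun s => (Real.smoothTransition s : ℂ)) t‖ ≤ K) (L : ℝ) {i : ℕ}
    (his : i ≤ s) :
    ‖iteratedDeriv i (fun t : ℝ =>
      cutoff J δ ζ L (Complex.exp (-(q : ℂ) * (t : ℂ) * Complex.I))) x‖ ≤
      i.factorial * K * (9 * q * s.factorial * R ^ 2) ^ i := by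
  have hsm : ContDiff ℝ ∞ (fun s => (Real.smoothTransition s : ℂ)) :=
    Complex.ofRealCLM.contDiff.comp Real.smoothTransition.contDiff
  have hh := contDiff_cauchySum q hδ hζ
  have := norm_iteratedFDeriv_comp_le hsm (contDiff_re_cauchySum_sub q hδ hζ L) (n := i)
    (by exact_mod_cast le_top) x (C := K) (D := 9 * q * s.factorial * R ^ 2)
    (fun l hl => by
      rw [norm_iteratedFDeriv_eq_norm_iteratedDeriv]; exact hK l (hl.trans his) _)
    (fun l hl hli => by
      rw [norm_iteratedFDeriv_eq_norm_iteratedDeriv]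
      have h1 := norm_iteratedDeriv_cauchySum_le_pow hq hδ hδ1 hζ hmass hR hx le_rfl hl
        (hli.trans his)
      rw [one_mul, mul_one] at h1
      refine le_trans ?_ h1
      have hl' : ((l : ℕ) : WithTop ℕ∞) ≤ ∞ := by exact_mod_cast le_top
      have h2 := iteratedDeriv_fun_sub (n := l) (x := x)
        (f := fun t : ℝ => Complex.reCLM
          (cauchySum J δ ζ (Complex.exp (-(q : ℂ) * (t : ℂ) * Complex.I)))) (g := fun _ => L)
        ((Complex.reCLM.contDiff.comp hh).of_le hl').contDiffAt contDiffAt_const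
      rw [iteratedDeriv_const, if_neg (by omega), sub_zero] at h2
      refine le_trans (le_of_eq (congrArg norm h2)) ?_
      rw [← norm_iteratedFDeriv_eq_norm_iteratedDeriv, ← norm_iteratedFDeriv_eq_norm_iteratedDeriv]
      refine (Complex.reCLM.norm_iteratedFDeriv_comp_left hh.contDiffAt hl').trans ?_
      rw [Complex.reCLM_norm, one_mul])
  rw [norm_iteratedFDeriv_eq_norm_iteratedDeriv] at this
  exact this

end CauchySum

/-- The nodes of generation less than `N` of the perfect symmetric set: the pair `⟨n, A⟩` with
`A ⊆ {0, …, n - 1}` stands for the point whose digits equal to `1` are those in `A`. -/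
def nodes (N : ℕ) : Finset (Σ _ : ℕ, Finset ℕ) :=
  (Finset.range N).sigma fun n => (Finset.range n).powerset

/-- The scale of a node. -/
def nodeScale (ξ : ℝ) (j : Σ _ : ℕ, Finset ℕ) : ℝ := ξ ^ j.1

/-- The point of the circle attached to a node. -/
def nodePoint (ξ : ℝ) (j : Σ _ : ℕ, Finset ℕ) : ℂ :=
  Complex.exp (2 * Real.pi * Complex.I * (((1 - ξ) * ∑ k ∈ j.2, ξ ^ k : ℝ) : ℂ))

section Nodes

variable {ξ : ℝ}

lemma norm_exp_two_pi_mul (x : ℝ) : ‖Complex.exp (2 * Real.pi * Complex.I * (x : ℂ))‖ = 1 := by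
  have : (2 * Real.pi * Complex.I * (x : ℂ)) = ((2 * Real.pi * x : ℝ) : ℂ) * Complex.I := by
    push_cast; ring
  rw [this, Complex.norm_exp_ofReal_mul_I]

lemma norm_exp_two_pi_mul_sub_le (x y : ℝ) :
    ‖Complex.exp (2 * Real.pi * Complex.I * (x : ℂ)) -
      Complex.exp (2 * Real.pi * Complex.I * (y : ℂ))‖ ≤ 2 * Real.pi * |x - y| := by
  have h : Complex.exp (2 * Real.pi * Complex.I * (x : ℂ)) -
      Complex.exp (2 * Real.pi * Complex.I * (y : ℂ)) =
      Complex.exp (2 * Real.pi * Complex.I * (y : ℂ)) *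
        (Complex.exp (Complex.I * ((2 * Real.pi * (x - y) : ℝ) : ℂ)) - 1) := by
    rw [mul_sub, mul_one, ← Complex.exp_add]
    congr 2
    push_cast
    ring
  rw [h, norm_mul, norm_exp_two_pi_mul, one_mul]
  refine (Real.norm_exp_I_mul_ofReal_sub_one_le).trans ?_
  rw [Real.norm_eq_abs, abs_mul, abs_of_nonneg Real.two_pi_pos.le]

lemma norm_nodePoint (j : Σ _ : ℕ, Finset ℕ) : ‖nodePoint ξ j‖ = 1 := norm_exp_two_pi_mul _

lemma nodePoint_mem_Eset (j : Σ _ : ℕ, Finset ℕ) : nodePoint ξ j ∈ Eset ξ := by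
  classical
  refine ⟨fun k => if k ∈ j.2 then 1 else 0, fun k => by dsimp only; split_ifs <;> simp, ?_⟩
  have h : ∑' k, ((if k ∈ j.2 then 1 else 0 : ℕ) : ℝ) * ξ ^ k = ∑ k ∈ j.2, ξ ^ k := by
    rw [tsum_eq_sum (s := j.2) (by intro k hk; simp [hk])]
    exact Finset.sum_congr rfl fun k hk => by simp [hk]
  rw [nodePoint, h]

lemma summable_digits (h0 : 0 ≤ ξ) (h1 : ξ < 1) {ε : ℕ → ℕ} (hε : ∀ k, ε k ≤ 1) :
    Summable fun k => (ε k : ℝ) * ξ ^ k := by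
  refine Summable.of_nonneg_of_le (fun k => by positivity) (fun k => ?_)
    (summable_geometric_of_lt_one h0 h1)
  have : (ε k : ℝ) ≤ 1 := by exact_mod_cast hε k
  exact mul_le_of_le_one_left (by positivity) this

lemma exists_node_near (h0 : 0 ≤ ξ) (h1 : ξ < 1) {e : ℂ} (he : e ∈ Eset ξ) (n : ℕ) :
    ∃ A ∈ (Finset.range n).powerset, ‖e - nodePoint ξ ⟨n, A⟩‖ ≤ 2 * Real.pi * ξ ^ n := by
  obtain ⟨ε, hε, rfl⟩ := he
  refine ⟨(Finset.range n).filter fun k => ε k = 1, by simp, ?_⟩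
  refine (norm_exp_two_pi_mul_sub_le _ _).trans ?_
  refine mul_le_mul_of_nonneg_left ?_ Real.two_pi_pos.le
  have hs := summable_digits h0 h1 hε
  have hA : ∑ k ∈ (Finset.range n).filter (fun k => ε k = 1), ξ ^ k =
      ∑ k ∈ Finset.range n, (ε k : ℝ) * ξ ^ k := by
    rw [Finset.sum_filter]
    refine Finset.sum_congr rfl fun k _ => ?_
    rcases Nat.le_one_iff_eq_zero_or_eq_one.mp (hε k) with h | h <;> simp [h]
  have hsplit := hs.sum_add_tsum_nat_add n
  have htail0 : 0 ≤ ∑' k, (ε (k + n) : ℝ) * ξ ^ (k + n) := tsum_nonneg fun k => by positivity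
  have htail : ∑' k, (ε (k + n) : ℝ) * ξ ^ (k + n) ≤ ξ ^ n * (1 - ξ)⁻¹ := by
    rw [← tsum_geometric_of_lt_one h0 h1, ← tsum_mul_left]
    refine ((summable_nat_add_iff n).mpr hs).tsum_le_tsum (fun k => ?_)
      ((summable_geometric_of_lt_one h0 h1).mul_left _)
    have : (ε (k + n) : ℝ) ≤ 1 := by exact_mod_cast hε _
    rw [pow_add, mul_comm (ξ ^ n)]
    exact mul_le_of_le_one_left (by positivity) this
  have hpos : 0 < 1 - ξ := by linarith
  rw [hA, ← mul_sub, ← hsplit, add_sub_cancel_left, abs_of_nonneg (by positivity)]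
  calc (1 - ξ) * _ ≤ (1 - ξ) * (ξ ^ n * (1 - ξ)⁻¹) := by gcongr
    _ = ξ ^ n := by field_simp

lemma nodeScale_pos (h0 : 0 < ξ) (j : Σ _ : ℕ, Finset ℕ) : 0 < nodeScale ξ j := pow_pos h0 _

lemma nodeScale_le_one (h0 : 0 ≤ ξ) (h1 : ξ ≤ 1) (j : Σ _ : ℕ, Finset ℕ) :
    nodeScale ξ j ≤ 1 := pow_le_one₀ h0 h1

lemma sum_nodeScale_le (h0 : 0 ≤ ξ) (h1 : ξ ≤ 1 / 3) (N : ℕ) :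
    ∑ j ∈ nodes N, nodeScale ξ j ≤ 3 := by
  unfold nodes nodeScale
  rw [Finset.sum_sigma]
  calc _ = ∑ n ∈ Finset.range N, (2 * ξ) ^ n := by
        refine Finset.sum_congr rfl fun n _ => ?_
        simp [mul_pow]
    _ ≤ ∑ n ∈ Finset.range N, (2 / 3 : ℝ) ^ n := by
        gcongr
        linarith
    _ ≤ ∑' n, (2 / 3 : ℝ) ^ n :=
        (summable_geometric_of_lt_one (by norm_num) (by norm_num)).sum_le_tsum _
          (fun n _ => by positivity)
    _ = 3 := by rw [tsum_geometric_of_lt_one (by norm_num) (by norm_num)]; norm_num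

lemma le_re_cauchySum_of_near (h0 : 0 < ξ) (h1 : ξ < 1) {e w : ℂ} (he : e ∈ Eset ξ)
    (hw : ‖w‖ ≤ 1) {n N : ℕ} (hn : n + 1 ≤ N) (h : ‖1 - e * w‖ ≤ 2 * ξ ^ n) :
    ((n : ℝ) + 1) / 100 ≤ (cauchySum (nodes N) (nodeScale ξ) (nodePoint ξ) w).re := by
  choose A hA hnear using exists_node_near h0.le h1 he
  set J' : Finset (Σ _ : ℕ, Finset ℕ) :=
    (Finset.range (n + 1)).image fun m => ⟨m, A m⟩ with hJ'
  have hcard : J'.card = n + 1 := by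
    rw [hJ', Finset.card_image_of_injective _ fun a b hab => by simpa using congrArg Sigma.fst hab,
      Finset.card_range]
  have := le_re_cauchySum_of_subset (J := nodes N) (J' := J') (δ := nodeScale ξ)
    (ζ := nodePoint ξ) (fun j _ => nodeScale_pos h0 j) (fun j _ => norm_nodePoint j) hw (by
      intro j hj
      obtain ⟨m, hm, rfl⟩ := Finset.mem_image.mp hj
      rw [Finset.mem_range] at hm
      exact Finset.mem_sigma.mpr ⟨Finset.mem_range.mpr (by dsimp only; omega), hA m⟩) (by
      intro j hj
      obtain ⟨m, hm, rfl⟩ := Finset.mem_image.mp hj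
      rw [Finset.mem_range] at hm
      have hsplit : 1 - nodePoint ξ ⟨m, A m⟩ * w =
          (1 - e * w) + (e - nodePoint ξ ⟨m, A m⟩) * w := by ring
      have hpow : ξ ^ n ≤ ξ ^ m := pow_le_pow_of_le_one h0.le h1.le (by omega)
      have h2 : ‖(e - nodePoint ξ ⟨m, A m⟩) * w‖ ≤ 2 * Real.pi * ξ ^ m := by
        rw [norm_mul]
        exact (mul_le_of_le_one_right (norm_nonneg _) hw).trans (hnear m)
      have hpi : 2 * Real.pi * ξ ^ m ≤ 7 * ξ ^ m := by
        have := Real.pi_lt_d2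
        have hm0 : 0 < ξ ^ m := pow_pos h0 m
        gcongr
        linarith
      rw [hsplit]
      refine (norm_add_le _ _).trans ?_
      unfold nodeScale
      linarith)
  rw [hcard] at this
  exact_mod_cast this

lemma exists_scale (h0 : 0 < ξ) (h1 : ξ < 1) {w : ℂ} (hw : ‖w‖ ≤ 1) (N : ℕ) :
    ∃ n ≤ N, (n : ℝ) / 100 ≤ (cauchySum (nodes N) (nodeScale ξ) (nodePoint ξ) w).re ∧
      ∀ j ∈ nodes N, ξ ^ n ≤ ‖1 + (nodeScale ξ j : ℂ) - nodePoint ξ j * w‖ := by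
  set h := (cauchySum (nodes N) (nodeScale ξ) (nodePoint ξ) w).re with hh
  have key : ∀ n ≤ N, (∃ n ≤ N, (n : ℝ) / 100 ≤ h ∧
      ∀ j ∈ nodes N, ξ ^ n ≤ ‖1 + (nodeScale ξ j : ℂ) - nodePoint ξ j * w‖) ∨
      (n : ℝ) / 100 ≤ h := by
    intro n
    induction n with
    | zero =>
      refine fun _ => Or.inr ?_
      have := le_re_cauchySum_of_subset (J := nodes N) (J' := ∅) (δ := nodeScale ξ)
        (ζ := nodePoint ξ) (fun j _ => nodeScale_pos h0 j) (fun j _ => norm_nodePoint j) hw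
        (by simp) (by simp)
      simpa using this
    | succ n ih =>
      intro hn
      rcases ih (by omega) with h2 | h2
      · exact Or.inl h2
      by_cases hnear : ∃ e ∈ Eset ξ, ‖1 - e * w‖ ≤ 2 * ξ ^ n
      · obtain ⟨e, he, hew⟩ := hnear
        right
        exact_mod_cast le_re_cauchySum_of_near h0 h1 he hw hn hew
      · push Not at hnear
        refine Or.inl ⟨n, by omega, h2, fun j _ => ?_⟩
        have h3 := hnear _ (nodePoint_mem_Eset j)
        have h4 := norm_one_sub_le_norm_one_add_sub (nodeScale_pos h0 j).le
          (norm_nodePoint (ξ := ξ) j) hw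
        have : 0 < ξ ^ n := pow_pos h0 n
        linarith
  rcases key N le_rfl with h2 | h2
  · exact h2
  · refine ⟨N, le_rfl, h2, fun j hj => le_trans ?_ (le_norm_one_add_sub (norm_nodePoint j) hw)⟩
    have hj1 := Finset.mem_range.mp (Finset.mem_sigma.mp hj).1
    exact pow_le_pow_of_le_one h0.le h1.le hj1.le

lemma pow_le_norm_one_add_sub (h0 : 0 < ξ) (h1 : ξ < 1) {w : ℂ} (hw : ‖w‖ ≤ 1) {N : ℕ} :
    ∀ j ∈ nodes N, ξ ^ N ≤ ‖1 + (nodeScale ξ j : ℂ) - nodePoint ξ j * w‖ := by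
  obtain ⟨n, hn, -, h⟩ := exists_scale h0 h1 hw N
  exact fun j hj => (pow_le_pow_of_le_one h0.le h1.le hn).trans (h j hj)

end Nodes

lemma pow_mem_Eset {p : ℕ} (hp : 2 ≤ p) {z : ℂ} (hz : z ∈ Eset (1 / (p : ℝ))) :
    z ^ p ∈ Eset (1 / (p : ℝ)) := by
  obtain ⟨ε, hε, rfl⟩ := hz
  refine ⟨fun k => ε (k + 1), fun k => hε _, ?_⟩
  have hp0 : (0 : ℝ) < p := by positivity
  have hp1 : (1 / p : ℝ) < 1 := by
    rw [div_lt_one hp0]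
    exact_mod_cast (by omega : 1 < p)
  have hs := summable_digits (by positivity) hp1 hε
  rw [← Complex.exp_nat_mul, Complex.exp_eq_exp_iff_exists_int]
  refine ⟨((p : ℤ) - 1) * ε 0, ?_⟩
  have hreal : (p : ℝ) * ((1 - 1 / p) * ∑' k, (ε k : ℝ) * (1 / p) ^ k) =
      (1 - 1 / p) * ∑' k, (ε (k + 1) : ℝ) * (1 / p) ^ k + (p - 1) * ε 0 := by
    rw [hs.tsum_eq_zero_add]
    have : ∑' k, (ε (k + 1) : ℝ) * (1 / p) ^ (k + 1) =
        1 / p * ∑' k, (ε (k + 1) : ℝ) * (1 / p) ^ k := by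
      rw [← tsum_mul_left]
      exact tsum_congr fun k => by ring
    rw [this]
    field_simp
    ring
  have hC := congrArg (fun x : ℝ => (2 * Real.pi * Complex.I) * (x : ℂ)) hreal
  push_cast at hC ⊢
  linear_combination hC

lemma pow_pow_mem_Eset {p : ℕ} (hp : 2 ≤ p) {z : ℂ} (hz : z ∈ Eset (1 / (p : ℝ))) (j : ℕ) :
    z ^ p ^ j ∈ Eset (1 / (p : ℝ)) := by
  induction j with
  | zero => simpa using hz
  | succ j ih => rw [pow_succ, pow_mul]; exact pow_mem_Eset hp ih

lemma exists_taylor_exp_cauchySum {ι : Type*} {J : Finset ι} {δ : ι → ℝ} {ζ : ι → ℂ} {d : ℝ}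
    (hd : 0 < d) (hδ : ∀ j ∈ J, d ≤ δ j) (hζ : ∀ j ∈ J, ‖ζ j‖ = 1) (C : ℝ) :
    ∃ b : ℕ → ℂ, b 0 = Complex.exp (-(C : ℂ) * cauchySum J δ ζ 0) ∧ (Summable fun n => ‖b n‖) ∧
      ∀ w : ℂ, ‖w‖ ≤ 1 → Complex.exp (-(C : ℂ) * cauchySum J δ ζ w) = ∑' n, b n * w ^ n := by
  set R : NNReal := ⟨1 + d / 2, by positivity⟩ with hR
  have hRr : (R : ℝ) = 1 + d / 2 := rfl
  set g : ℂ → ℂ := fun w => Complex.exp (-(C : ℂ) * cauchySum J δ ζ w) with hg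
  have hdiff : DifferentiableOn ℂ g (Metric.closedBall 0 R) := by
    refine DifferentiableOn.cexp (DifferentiableOn.const_mul ?_ _)
    unfold cauchySum
    refine DifferentiableOn.fun_sum fun j hj => DifferentiableOn.const_mul ?_ _
    refine DifferentiableOn.inv (by fun_prop) fun w hw h0 => ?_
    rw [mem_closedBall_zero_iff, hRr] at hw
    have h1 : ‖(1 + (δ j : ℂ))‖ = ‖ζ j * w‖ := by rw [sub_eq_zero.mp h0]
    have h2 : (1 : ℂ) + (δ j : ℂ) = ((1 + δ j : ℝ) : ℂ) := by push_cast; rfl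
    rw [norm_mul, hζ j hj, one_mul, h2, Complex.norm_real,
      Real.norm_of_nonneg (by linarith [hδ j hj])] at h1
    linarith [hδ j hj]
  have hps := hdiff.hasFPowerSeriesOnBall (by rw [← NNReal.coe_pos, hRr]; positivity)
  set P := cauchyPowerSeries g 0 R with hP
  have hmem : ∀ w : ℂ, ‖w‖ ≤ 1 → w ∈ Metric.eball (0 : ℂ) R := by
    intro w hw
    rw [Metric.eball_coe, mem_ball_zero_iff, hRr]
    linarith
  refine ⟨P.coeff, ?_, ?_, fun w hw => ?_⟩
  · exact hps.coeff_zero _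
  · have := P.summable_norm_apply (x := 1)
      (Metric.eball_subset_eball hps.r_le (hmem 1 (by simp)))
    simpa using this
  · have := hps.hasSum (hmem w hw)
    rw [zero_add] at this
    refine Eq.trans this.tsum_eq.symm (tsum_congr fun n => ?_)
    rw [FormalMultilinearSeries.apply_eq_pow_smul_coeff, smul_eq_mul, mul_comm]

lemma exp_int_mul_pow (q : ℤ) (t : ℝ) (n : ℕ) :
    Complex.exp (-(q : ℂ) * t * Complex.I) ^ n =
      Complex.exp (-((n * q : ℤ) : ℂ) * t * Complex.I) := by
  rw [← Complex.exp_nat_mul]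
  congr 1
  push_cast
  ring

lemma exp_neg_mul_le_pow {C h a : ℝ} {n : ℕ} (hC : 0 ≤ C) (ha : Real.exp (-C / 100) ≤ a)
    (h0 : (n : ℝ) / 100 ≤ h) : Real.exp (-C * h) ≤ a ^ n := by
  calc Real.exp (-C * h) ≤ Real.exp (n * (-C / 100)) := by
        apply Real.exp_le_exp.mpr
        have := mul_le_mul_of_nonneg_left h0 hC
        linarith
    _ = Real.exp (-C / 100) ^ n := Real.exp_nat_mul _ _
    _ ≤ a ^ n := by gcongr

lemma norm_taylor_mul_sq_le {ξ C : ℝ} (h0 : 0 < ξ) (h1 : ξ ≤ 1 / 3) (hC : 1 ≤ C)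
    (hCξ : Real.exp (-C / 100) ≤ ξ ^ 4) {N : ℕ} {b : ℕ → ℂ} (hb : Summable fun n => ‖b n‖)
    (hg : ∀ w : ℂ, ‖w‖ ≤ 1 → Complex.exp (-(C : ℂ) *
      cauchySum (nodes N) (nodeScale ξ) (nodePoint ξ) w) = ∑' n, b n * w ^ n) (n : ℕ) :
    ‖b n‖ * (n : ℝ) ^ 2 ≤ 2 * (18 * C) ^ 2 := by
  have h1' : ξ < 1 := by linarith
  have hδ : ∀ j ∈ nodes N, 0 < nodeScale ξ j := fun j _ => nodeScale_pos h0 j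
  have hζ : ∀ j ∈ nodes N, ‖nodePoint ξ j‖ = 1 := fun j _ => norm_nodePoint j
  set F : ℝ → ℂ := fun t => Complex.exp (-(C : ℂ) * cauchySum (nodes N) (nodeScale ξ)
    (nodePoint ξ) (Complex.exp (-((1 : ℤ) : ℂ) * (t : ℂ) * Complex.I))) with hF
  have hFp : PeriodicSmooth F :=
    ⟨contDiff_exp_cauchySum 1 hδ hζ C, fun θ => by simp only [hF, exp_int_mul_add_two_pi]⟩
  have hsum : F = fun t : ℝ => ∑' m, b m * Complex.exp (-((m : ℤ) : ℂ) * t * Complex.I) := by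
    ext t
    rw [hF]
    dsimp only
    rw [hg _ (norm_exp_int_mul 1 t).le]
    refine tsum_congr fun m => ?_
    rw [exp_int_mul_pow, mul_one]
  have hcoeff : testCoeff F (-n) = b n := by
    rw [hsum, testCoeff_tsum_exp hb (fun m : ℕ => (m : ℤ))]
    rw [tsum_eq_single n (fun m hm => by simp [hm])]
    simp
  have hbound : ∀ t, ‖iteratedDeriv 2 F t‖ ≤ 2 * (18 * C) ^ 2 := by
    intro t
    have hw := (norm_exp_int_mul 1 t).le
    obtain ⟨m, -, hre, hsc⟩ := exists_scale h0 h1' hw N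
    have hR : 1 ≤ (ξ ^ m)⁻¹ := (one_le_inv₀ (by positivity)).mpr (pow_le_one₀ h0.le h1'.le)
    have := norm_iteratedDeriv_exp_cauchySum_le (q := 1) (J := nodes N) (δ := nodeScale ξ)
      (ζ := nodePoint ξ) le_rfl hδ (fun j _ => nodeScale_le_one h0.le h1'.le j) hζ
      (sum_nodeScale_le h0.le h1 N) hR (x := t)
      (fun j hj => by rw [norm_inv]; exact inv_anti₀ (by positivity) (hsc j hj)) hC (le_refl 2)
    refine this.trans ?_
    have he := exp_neg_mul_le_pow (by linarith) hCξ hre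
    calc _ ≤ ((2 : ℕ).factorial : ℝ) * (ξ ^ 4) ^ m *
          (9 * C * ((1 : ℤ) : ℝ) * (2 : ℕ).factorial * (ξ ^ m)⁻¹ ^ 2) ^ 2 := by
          gcongr
      _ = _ := by
          have : ξ ^ m ≠ 0 := by positivity
          have h4 : (ξ ^ 4) ^ m = (ξ ^ m) ^ 4 := by rw [← pow_mul, ← pow_mul, mul_comm]
          rw [h4]
          simp only [Nat.factorial, Int.cast_one]
          push_cast
          field_simp
          ring
  have := hFp.norm_testCoeff_mul_pow_le hbound (-n)
  rw [hcoeff] at this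
  simpa using this

lemma iteratedDeriv_exp_mul_I (c : ℂ) (i : ℕ) :
    iteratedDeriv i (fun t : ℝ => Complex.exp (c * (t : ℂ) * Complex.I)) =
      fun t : ℝ => (c * Complex.I) ^ i * Complex.exp (c * (t : ℂ) * Complex.I) := by
  induction i with
  | zero => simp
  | succ i ih =>
    rw [iteratedDeriv_succ, ih]
    ext t
    rw [((hasDerivAt_exp_mul_I c t).const_mul _).deriv]
    ring

lemma norm_iteratedDeriv_exp_int_mul (m : ℤ) (i : ℕ) (x : ℝ) :
    ‖iteratedDeriv i (fun t : ℝ => Complex.exp (-(m : ℂ) * (t : ℂ) * Complex.I)) x‖ =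
      |(m : ℝ)| ^ i := by
  rw [iteratedDeriv_exp_mul_I, norm_mul, norm_exp_int_mul, mul_one, norm_pow, norm_mul, norm_neg,
    Complex.norm_I, mul_one, Complex.norm_intCast]

section Peak

variable {ξ : ℝ}

/-- The peak function `exp (-C h)` composed with `θ ↦ e^{-iqθ}` and modulated by `e^{-imθ}`. -/
def modulatedPeak (ξ C : ℝ) (N : ℕ) (q m : ℤ) (t : ℝ) : ℂ :=
  Complex.exp (-(C : ℂ) * cauchySum (nodes N) (nodeScale ξ) (nodePoint ξ)
    (Complex.exp (-(q : ℂ) * (t : ℂ) * Complex.I))) *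
    Complex.exp (-(m : ℂ) * (t : ℂ) * Complex.I)

/-- The cutoff localizing to the points where the `N`-th peak function is almost as small as on the
perfect symmetric set. -/
def peakCutoff (ξ : ℝ) (N : ℕ) (q : ℤ) (t : ℝ) : ℂ :=
  cutoff (nodes N) (nodeScale ξ) (nodePoint ξ) ((N : ℝ) / 100 - 2)
    (Complex.exp (-(q : ℂ) * (t : ℂ) * Complex.I))

lemma periodicSmooth_modulatedPeak (h0 : 0 < ξ) (C : ℝ) (N : ℕ) (q m : ℤ) :
    PeriodicSmooth (modulatedPeak ξ C N q m) :=
  ⟨(contDiff_exp_cauchySum q (fun j _ => nodeScale_pos h0 j) (fun j _ => norm_nodePoint j) C).mul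
    (contDiff_exp_mul_I _), fun θ => by unfold modulatedPeak; simp only [exp_int_mul_add_two_pi]⟩

lemma periodicSmooth_peakCutoff (h0 : 0 < ξ) (N : ℕ) (q : ℤ) :
    PeriodicSmooth (peakCutoff ξ N q) :=
  ⟨contDiff_cutoff q (fun j _ => nodeScale_pos h0 j) (fun j _ => norm_nodePoint j) _,
    fun θ => by unfold peakCutoff; simp only [exp_int_mul_add_two_pi]⟩

lemma exists_bound_peakCutoff_mul_modulatedPeak (h0 : 0 < ξ) (h1 : ξ ≤ 1 / 3) {C : ℝ} (hC : 1 ≤ C)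
    {s : ℕ} (hCξ : Real.exp (-C / 100) ≤ ξ ^ (2 * s + 4)) {q : ℤ} (hq : 1 ≤ q) (m : ℤ) :
    ∃ M : ℝ, ∀ N : ℕ, ∀ i ≤ s, ∀ x : ℝ,
      ‖iteratedDeriv i (fun t => peakCutoff ξ N q t * modulatedPeak ξ C N q m t) x‖ ≤
        M * (ξ ^ 4) ^ N := by
  obtain ⟨K, hK0, hK⟩ := exists_bound_iteratedDeriv_smoothTransition s
  have h1' : ξ < 1 := by linarith
  have hq' : (1 : ℝ) ≤ q := by exact_mod_cast hq
  have hs1 : (1 : ℝ) ≤ s.factorial := by exact_mod_cast Nat.factorial_pos s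
  set D₀ : ℝ := 9 * C * q * s.factorial + |(m : ℝ)| with hD₀
  have hD₀1 : 1 ≤ D₀ := by
    have : 1 * 1 * 1 * 1 ≤ 9 * C * q * s.factorial := by gcongr; norm_num
    have := abs_nonneg (m : ℝ)
    linarith
  refine ⟨s.factorial * K * (s.factorial * Real.exp (2 * C)) * (4 * D₀) ^ s, fun N i hi x => ?_⟩
  have hδ : ∀ j ∈ nodes N, 0 < nodeScale ξ j := fun j _ => nodeScale_pos h0 j
  have hδ1 : ∀ j ∈ nodes N, nodeScale ξ j ≤ 1 := fun j _ => nodeScale_le_one h0.le h1'.le j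
  have hζ : ∀ j ∈ nodes N, ‖nodePoint ξ j‖ = 1 := fun j _ => norm_nodePoint j
  have hmass := sum_nodeScale_le h0.le h1 N
  set H : ℝ → ℝ := fun t => (cauchySum (nodes N) (nodeScale ξ) (nodePoint ξ)
    (Complex.exp (-(q : ℂ) * (t : ℂ) * Complex.I))).re - ((N : ℝ) / 100 - 2) with hH
  have hHc : Continuous H := (contDiff_re_cauchySum_sub q hδ hζ _).continuous
  rcases lt_or_ge (H x) 0 with hx | hx
  · have hev : (fun t => peakCutoff ξ N q t * modulatedPeak ξ C N q m t) =ᶠ[nhds x]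
        fun _ => (0 : ℂ) := by
      filter_upwards [hHc.continuousAt.eventually_lt continuousAt_const hx] with t ht
      have : peakCutoff ξ N q t = 0 := by
        unfold peakCutoff cutoff
        rw [Real.smoothTransition.zero_of_nonpos ht.le, Complex.ofReal_zero]
      rw [this, zero_mul]
    rw [hev.iteratedDeriv_eq i, iteratedDeriv_const]
    simp only [ite_self, norm_zero]
    positivity
  · set R : ℝ := (ξ ^ N)⁻¹ with hR
    have hR1 : 1 ≤ R := (one_le_inv₀ (by positivity)).mpr (pow_le_one₀ h0.le h1'.le)
    have hRj : ∀ j ∈ nodes N, ‖(1 + (nodeScale ξ j : ℂ) -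
        nodePoint ξ j * Complex.exp (-(q : ℂ) * (x : ℂ) * Complex.I))⁻¹‖ ≤ R := fun j hj => by
      rw [norm_inv]
      exact inv_anti₀ (by positivity)
        (pow_le_norm_one_add_sub h0 h1' (norm_exp_int_mul q x).le j hj)
    have hR2 : 1 ≤ R ^ 2 := one_le_pow₀ hR1
    have habs := abs_nonneg (m : ℝ)
    have hD1 : 9 * q * s.factorial * R ^ 2 ≤ D₀ * R ^ 2 := by
      gcongr
      have : 9 * 1 * q * s.factorial ≤ 9 * C * q * s.factorial := by gcongr
      linarith
    have hD2 : 9 * C * q * s.factorial * R ^ 2 ≤ D₀ * R ^ 2 := by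
      gcongr
      linarith
    have hD3 : |(m : ℝ)| ≤ D₀ * R ^ 2 := by
      have : |(m : ℝ)| ≤ D₀ := by
        have : 0 ≤ 9 * C * q * s.factorial := by positivity
        linarith
      exact this.trans (le_mul_of_one_le_right (by linarith) hR2)
    have hexp : Real.exp (-C * (cauchySum (nodes N) (nodeScale ξ) (nodePoint ξ)
        (Complex.exp (-(q : ℂ) * (x : ℂ) * Complex.I))).re) ≤
        Real.exp (2 * C) * (ξ ^ (2 * s + 4)) ^ N := by
      have h2 := exp_neg_mul_le_pow (n := N) (by linarith) hCξ (le_refl ((N : ℝ) / 100))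
      calc _ ≤ Real.exp (2 * C + -C * ((N : ℝ) / 100)) := by
            apply Real.exp_le_exp.mpr
            have := mul_nonneg (by linarith : (0 : ℝ) ≤ C) hx
            simp only [hH] at this
            linarith
        _ ≤ _ := by
            rw [Real.exp_add]
            gcongr
    have ha := fun l (hl : l ≤ s) => norm_iteratedDeriv_cutoff_le hq hδ hδ1 hζ hmass hR1 hRj hK
      ((N : ℝ) / 100 - 2) hl
    have hb := fun l (hl : l ≤ s) => norm_iteratedDeriv_exp_cauchySum_le hq hδ hδ1 hζ hmass hR1 hRj
      hC hl
    have hfac : ∀ l ≤ s, (l.factorial : ℝ) ≤ s.factorial := fun l hl => by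
      exact_mod_cast Nat.factorial_le hl
    have hbc := norm_iteratedDeriv_mul_le_geom (n := s) (x := x)
      (a := s.factorial * (Real.exp (2 * C) * (ξ ^ (2 * s + 4)) ^ N)) (b := 1) (D := D₀ * R ^ 2)
      (contDiff_exp_cauchySum q hδ hζ C) (contDiff_exp_mul_I (-(m : ℂ))) (by positivity)
      (fun l hl => (hb l hl).trans (by
        have := hfac l hl
        gcongr)) (fun l hl => by
        rw [norm_iteratedDeriv_exp_int_mul, one_mul]
        gcongr)
    have habc := norm_iteratedDeriv_mul_le_geom (n := s) (x := x)
      (a := s.factorial * K) (D := 2 * (D₀ * R ^ 2))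
      (periodicSmooth_peakCutoff h0 N q).1 (periodicSmooth_modulatedPeak h0 C N q m).1
      (by positivity) (fun l hl => (ha l hl).trans (by
        have := hfac l hl
        have : 9 * q * s.factorial * R ^ 2 ≤ 2 * (D₀ * R ^ 2) := by
          have : 0 ≤ D₀ * R ^ 2 := by positivity
          linarith
        gcongr)) hbc i hi
    refine habc.trans ?_
    have hbase : 1 ≤ 2 * (2 * (D₀ * R ^ 2)) := by
      have : 1 * 1 ≤ D₀ * R ^ 2 := by gcongr
      linarith
    calc _ ≤ s.factorial * K * (s.factorial * (Real.exp (2 * C) * (ξ ^ (2 * s + 4)) ^ N) * 1) *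
          (2 * (2 * (D₀ * R ^ 2))) ^ s := by
          gcongr
      _ = _ := by
          have hx0 : ξ ^ N ≠ 0 := by positivity
          have e1 : (ξ ^ (2 * s + 4)) ^ N = ((ξ ^ N) ^ s) ^ 2 * (ξ ^ N) ^ 4 := by
            rw [← pow_mul, ← pow_mul, ← pow_mul, ← pow_mul, ← pow_add]
            congr 1
            ring
          have e2 : (ξ ^ 4) ^ N = (ξ ^ N) ^ 4 := by rw [← pow_mul, ← pow_mul, mul_comm]
          have e3 : 2 * (2 * (D₀ * R ^ 2)) = (4 * D₀) * R ^ 2 := by ring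
          rw [e1, e2, e3, mul_pow (4 * D₀), hR]
          have e4 : ((ξ ^ N)⁻¹ ^ 2) ^ s = (((ξ ^ N) ^ s) ^ 2)⁻¹ := by
            rw [pow_right_comm, inv_pow, inv_pow]
          rw [e4]
          field_simp

lemma continuousAt_cauchySum {ι : Type*} {J : Finset ι} {δ : ι → ℝ} {ζ : ι → ℂ}
    (hδ : ∀ j ∈ J, 0 < δ j) (hζ : ∀ j ∈ J, ‖ζ j‖ = 1) {w : ℂ} (hw : ‖w‖ ≤ 1) :
    ContinuousAt (cauchySum J δ ζ) w := by
  refine tendsto_finsetSum _ fun j hj => ?_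
  have : ContinuousAt (fun w : ℂ => 1 + (δ j : ℂ) - ζ j * w) w := by fun_prop
  exact (this.inv₀ (one_add_sub_ne_zero (hδ j hj) (hζ j hj) hw)).tendsto.const_mul _

lemma div_le_re_cauchySum_of_mem (h0 : 0 < ξ) (h1 : ξ < 1) {e w : ℂ} (he : e ∈ Eset ξ)
    (hw : ‖w‖ ≤ 1) (hew : e * w = 1) (N : ℕ) :
    (N : ℝ) / 100 ≤ (cauchySum (nodes N) (nodeScale ξ) (nodePoint ξ) w).re := by
  cases N with
  | zero => rw [show nodes 0 = ∅ from rfl]; simp [cauchySum]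
  | succ n =>
    have := le_re_cauchySum_of_near h0 h1 he hw (le_refl (n + 1))
      (by rw [hew, sub_self, norm_zero]; positivity)
    exact_mod_cast this

lemma norm_of_mem_Eset {z : ℂ} (hz : z ∈ Eset ξ) : ‖z‖ = 1 := by
  obtain ⟨ε, -, rfl⟩ := hz
  exact norm_exp_two_pi_mul _

lemma distAct_one_sub_peakCutoff_mul {S : CircleDistribution} (h0 : 0 < ξ) (h1 : ξ < 1)
    (hS : distSupport S ⊆ Eset ξ) {q : ℕ} (hq : ∀ z ∈ Eset ξ, z ^ q ∈ Eset ξ) (N : ℕ)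
    {φ : ℝ → ℂ} (hφ : PeriodicSmooth φ) :
    distAct S (fun t => (1 + (-1) * peakCutoff ξ N (q : ℤ) t) * φ t) = 0 := by
  have hc : ∀ c : ℂ, PeriodicSmooth fun _ => c := fun c => ⟨contDiff_const, fun _ => rfl⟩
  refine distAct_eq_zero_of_vanish_near S hS
    (((hc 1).add ((hc (-1)).mul (periodicSmooth_peakCutoff h0 N q))).mul hφ) fun z hz => ?_
  have hz1 := norm_of_mem_Eset hz
  have hw : ‖(starRingEnd ℂ z) ^ q‖ = 1 := by
    rw [norm_pow, Complex.norm_conj, hz1, one_pow]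
  have hzw : z ^ q * (starRingEnd ℂ z) ^ q = 1 := by
    rw [← mul_pow, Complex.mul_conj, Complex.normSq_eq_norm_sq, hz1]
    simp
  have hre := div_le_re_cauchySum_of_mem h0 h1 (hq z hz) hw.le hzw N
  have hcont : ContinuousAt (fun u : ℂ => (cauchySum (nodes N) (nodeScale ξ) (nodePoint ξ)
      ((starRingEnd ℂ u) ^ q)).re) z := by
    have h2 : ContinuousAt (fun u : ℂ => (starRingEnd ℂ u) ^ q) z :=
      (Complex.continuous_conj.pow q).continuousAt
    exact Complex.continuous_re.continuousAt.comp (ContinuousAt.comp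
      (f := fun u : ℂ => (starRingEnd ℂ u) ^ q) (continuousAt_cauchySum
      (fun j _ => nodeScale_pos h0 j) (fun j _ => norm_nodePoint j) hw.le) h2)
  have hev := continuousAt_const.eventually_lt hcont
    (show (N : ℝ) / 100 - 1 < _ by linarith)
  obtain ⟨U, hU, hUo, hzU⟩ := _root_.mem_nhds_iff.mp hev
  refine ⟨U, hUo, hzU, fun θ hθ => ?_⟩
  have h3 := hU hθ
  have h4 : (starRingEnd ℂ (Complex.exp ((θ : ℂ) * Complex.I))) ^ q =
      Complex.exp (-((q : ℤ) : ℂ) * (θ : ℂ) * Complex.I) := by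
    rw [← Complex.exp_conj, ← Complex.exp_nat_mul]
    congr 1
    simp
    ring
  rw [Set.mem_ofPred_eq, h4] at h3
  have h5 : peakCutoff ξ N (q : ℤ) θ = 1 := by
    unfold peakCutoff cutoff
    rw [Real.smoothTransition.one_of_one_le (by linarith), Complex.ofReal_one]
  rw [h5]
  ring

lemma exp_neg_le_norm_exp_cauchySum_zero (h0 : 0 < ξ) (h1 : ξ ≤ 1 / 3) {C : ℝ} (hC : 0 ≤ C)
    (N : ℕ) : Real.exp (-(3 * C)) ≤
      ‖Complex.exp (-(C : ℂ) * cauchySum (nodes N) (nodeScale ξ) (nodePoint ξ) 0)‖ := by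
  have h : ‖cauchySum (nodes N) (nodeScale ξ) (nodePoint ξ) 0‖ ≤ 3 := by
    refine le_trans ?_ (sum_nodeScale_le h0.le h1 N)
    refine (norm_sum_le _ _).trans (Finset.sum_le_sum fun j _ => ?_)
    have hj := nodeScale_pos h0 j
    have h2 : (1 : ℂ) + (nodeScale ξ j : ℂ) = ((1 + nodeScale ξ j : ℝ) : ℂ) := by
      push_cast; rfl
    rw [mul_zero, sub_zero, norm_mul, Complex.norm_real, Real.norm_of_nonneg hj.le, norm_inv, h2,
      Complex.norm_real, Real.norm_of_nonneg (by linarith)]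
    exact mul_le_of_le_one_right hj.le (inv_le_one_of_one_le₀ (by linarith))
  rw [Complex.norm_exp]
  apply Real.exp_le_exp.mpr
  have h3 := (Complex.re_le_norm _).trans h
  have h4 : (-(C : ℂ) * cauchySum (nodes N) (nodeScale ξ) (nodePoint ξ) 0).re =
      -(C * (cauchySum (nodes N) (nodeScale ξ) (nodePoint ξ) 0).re) := by simp
  rw [h4]
  have := mul_le_mul_of_nonneg_left h3 hC
  linarith

end Peak

lemma norm_mul_norm_le_of_tail {b c : ℕ → ℂ} {V η : ℝ}
    (hV : ∀ n, ‖b n‖ * (n : ℝ) ^ 2 ≤ V) (hc : ∀ n, ‖c (n + 1)‖ ≤ η) :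
    ‖b 0‖ * ‖c 0‖ ≤ η * V * (∑' n : ℕ, 1 / ((n : ℝ) + 1) ^ 2) + ‖∑' n, b n * c n‖ := by
  have hZ : Summable fun n : ℕ => 1 / ((n : ℝ) + 1) ^ 2 := by
    have := (summable_nat_add_iff 1).mpr (Real.summable_one_div_nat_pow.mpr (le_refl 2))
    simpa using this
  have hterm : ∀ n, ‖b (n + 1) * c (n + 1)‖ ≤ η * V * (1 / ((n : ℝ) + 1) ^ 2) := fun n => by
    have h2 := hV (n + 1)
    push_cast at h2
    have h3 : ‖b (n + 1)‖ ≤ V / ((n : ℝ) + 1) ^ 2 := by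
      rw [le_div_iff₀ (by positivity)]
      exact h2
    rw [norm_mul]
    calc _ ≤ V / ((n : ℝ) + 1) ^ 2 * η := mul_le_mul h3 (hc n) (norm_nonneg _)
          ((norm_nonneg _).trans h3)
      _ = _ := by ring
  have hs' : Summable fun n => b (n + 1) * c (n + 1) :=
    Summable.of_norm_bounded (hZ.mul_left (η * V)) hterm
  have hs : Summable fun n => b n * c n := (summable_nat_add_iff 1).mp hs'
  have htail : ‖∑' n, b (n + 1) * c (n + 1)‖ ≤ η * V * ∑' n : ℕ, 1 / ((n : ℝ) + 1) ^ 2 := by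
    rw [← tsum_mul_left]
    exact tsum_of_norm_bounded (hZ.mul_left (η * V)).hasSum hterm
  have hsplit : b 0 * c 0 = ∑' n, b n * c n - ∑' n, b (n + 1) * c (n + 1) := by
    rw [hs.tsum_eq_zero_add]
    ring
  rw [← norm_mul, hsplit]
  refine (norm_sub_le _ _).trans ?_
  linarith

lemma norm_coeff_le_of_tail_le {ξ : ℝ} (h0 : 0 < ξ) (h1 : ξ ≤ 1 / 3) {S : CircleDistribution}
    (hS : distSupport S ⊆ Eset ξ) {s : ℕ} {A C : ℝ}
    (hA : ∀ (φ : ℝ → ℂ) (B : ℝ), PeriodicSmooth φ → (∀ t, ‖φ t‖ ≤ B) →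
      (∀ t, ‖iteratedDeriv s φ t‖ ≤ B) → ‖distAct S φ‖ ≤ A * B)
    (hC : 1 ≤ C) (hCξ : Real.exp (-C / 100) ≤ ξ ^ (2 * s + 4)) {q : ℕ} (hq1 : 1 ≤ q)
    (hq : ∀ z ∈ Eset ξ, z ^ q ∈ Eset ξ) (m : ℤ) {η : ℝ}
    (hη : ∀ n : ℕ, ‖S.coeff (((n + 1 : ℕ) : ℤ) * q + m)‖ ≤ η) :
    Real.exp (-(3 * C)) * ‖S.coeff m‖ ≤
      η * (2 * (18 * C) ^ 2) * ∑' n : ℕ, 1 / ((n : ℝ) + 1) ^ 2 := by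
  have h1' : ξ < 1 := by linarith
  obtain ⟨M, hM⟩ := exists_bound_peakCutoff_mul_modulatedPeak h0 h1 hC hCξ
    (q := q) (by exact_mod_cast hq1) m
  have hC4 : Real.exp (-C / 100) ≤ ξ ^ 4 :=
    hCξ.trans (pow_le_pow_of_le_one h0.le h1'.le (by omega))
  have hbound : ∀ N : ℕ, Real.exp (-(3 * C)) * ‖S.coeff m‖ ≤
      η * (2 * (18 * C) ^ 2) * ∑' n : ℕ, 1 / ((n : ℝ) + 1) ^ 2 + A * (M * (ξ ^ 4) ^ N) := by
    intro N
    obtain ⟨b, hb0, hb, hg⟩ := exists_taylor_exp_cauchySum (J := nodes N) (δ := nodeScale ξ)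
      (ζ := nodePoint ξ) (pow_pos h0 N) (fun j hj => pow_le_pow_of_le_one h0.le h1'.le
        (Finset.mem_range.mp (Finset.mem_sigma.mp hj).1).le) (fun j _ => norm_nodePoint j) C
    have hV := norm_taylor_mul_sq_le h0 h1 hC hC4 hb hg
    have hkey := norm_mul_norm_le_of_tail (c := fun n : ℕ => S.coeff ((n : ℤ) * q + m)) hV hη
    have hφ := periodicSmooth_modulatedPeak h0 C N q m
    have hseries : distAct S (modulatedPeak ξ C N q m) =
        ∑' n, b n * S.coeff ((n : ℤ) * q + m) := by
      have hinj : Function.Injective fun n : ℕ => (n : ℤ) * q + m := by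
        intro n n' h
        have hq0 : q ≠ 0 := by omega
        simpa [hq0] using h
      rw [← distAct_tsum_exp S hb hinj]
      congr 1
      ext t
      unfold modulatedPeak
      rw [hg _ (norm_exp_int_mul q t).le, ← tsum_mul_right]
      refine tsum_congr fun n => ?_
      rw [exp_int_mul_pow, mul_assoc, ← Complex.exp_add]
      congr 2
      push_cast
      ring
    have hc : ∀ c : ℂ, PeriodicSmooth fun _ => c := fun c => ⟨contDiff_const, fun _ => rfl⟩
    have hχ := periodicSmooth_peakCutoff h0 N q
    have hsplit : distAct S (modulatedPeak ξ C N q m) =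
        distAct S (fun t => peakCutoff ξ N q t * modulatedPeak ξ C N q m t) := by
      have := distAct_add S (hχ.mul hφ) (((hc 1).add ((hc (-1)).mul hχ)).mul hφ)
      rw [distAct_one_sub_peakCutoff_mul h0 h1' hS hq N hφ, add_zero] at this
      rw [← this]
      congr 1
      ext t
      ring
    have hsmall : ‖distAct S (modulatedPeak ξ C N q m)‖ ≤ A * (M * (ξ ^ 4) ^ N) := by
      rw [hsplit]
      exact hA _ _ (hχ.mul hφ) (fun t => by simpa using hM N 0 (Nat.zero_le _) t)
        (fun t => hM N s le_rfl t)
    rw [← hseries] at hkey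
    have he := exp_neg_le_norm_exp_cauchySum_zero h0 h1 (C := C) (by linarith) N
    rw [← hb0] at he
    have := mul_le_mul_of_nonneg_right he (norm_nonneg (S.coeff m))
    simp only [Nat.cast_zero, zero_mul, zero_add] at hkey
    linarith
  have hlim : Tendsto (fun N : ℕ => η * (2 * (18 * C) ^ 2) * ∑' n : ℕ, 1 / ((n : ℝ) + 1) ^ 2 +
      A * (M * (ξ ^ 4) ^ N)) atTop
      (nhds (η * (2 * (18 * C) ^ 2) * ∑' n : ℕ, 1 / ((n : ℝ) + 1) ^ 2 + A * (M * 0))) :=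
    (((tendsto_pow_atTop_nhds_zero_of_lt_one (by positivity)
      (pow_lt_one₀ h0.le h1' (by norm_num))).const_mul M).const_mul A).const_add _
  simpa using ge_of_tendsto' hlim hbound

/-- If `p ≥ 3` and `S` is a distribution on the circle supported in
`E_{1/p}` with `Ŝ(n) → 0` as `n → +∞`, then `S = 0`. -/
theorem stmt_14 (p : ℕ) (hp : 3 ≤ p) (S : CircleDistribution)
    (hsupp : distSupport S ⊆ Eset (1 / (p : ℝ)))
    (hlim : Filter.Tendsto S.coeff Filter.atTop (nhds 0)) :
    ∀ n : ℤ, S.coeff n = 0 := by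
  intro m
  have hp3 : (3 : ℝ) ≤ p := by exact_mod_cast hp
  have h0 : (0 : ℝ) < 1 / p := by positivity
  have h1 : (1 : ℝ) / p ≤ 1 / 3 := by gcongr
  obtain ⟨A, s, -, hA⟩ := exists_norm_distAct_le S
  set C : ℝ := 100 * ((2 * s + 4 : ℕ) * Real.log p) + 1 with hC
  have hlog : 0 ≤ Real.log p := Real.log_nonneg (by linarith)
  have hC1 : 1 ≤ C := le_add_of_nonneg_left (by positivity)
  have hCξ : Real.exp (-C / 100) ≤ (1 / (p : ℝ)) ^ (2 * s + 4) := by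
    have h : Real.exp ((2 * s + 4 : ℕ) * -Real.log p) = (1 / (p : ℝ)) ^ (2 * s + 4) := by
      rw [Real.exp_nat_mul, Real.exp_neg, Real.exp_log (by linarith), one_div]
    rw [← h]
    apply Real.exp_le_exp.mpr
    rw [hC]
    linarith
  set W : ℝ := 2 * (18 * C) ^ 2 * ∑' n : ℕ, 1 / ((n : ℝ) + 1) ^ 2 with hW
  have hle : ∀ η : ℝ, 0 < η → Real.exp (-(3 * C)) * ‖S.coeff m‖ ≤ η * W := by
    intro η hη
    obtain ⟨a, ha⟩ := eventually_atTop.mp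
      (hlim.eventually (Metric.closedBall_mem_nhds (0 : ℂ) hη))
    have hpow : ((a - m).toNat : ℤ) ≤ ((p ^ (a - m).toNat : ℕ) : ℤ) := by
      exact_mod_cast (Nat.lt_pow_self (by omega)).le
    have hq1 : 1 ≤ p ^ (a - m).toNat := Nat.one_le_pow _ _ (by omega)
    have := norm_coeff_le_of_tail_le h0 h1 hsupp hA hC1 hCξ hq1
      (fun z hz => pow_pow_mem_Eset (by omega) hz _) m (η := η) (fun n => by
        refine mem_closedBall_zero_iff.mp (ha _ ?_)
        have h2 : ((p ^ (a - m).toNat : ℕ) : ℤ) ≤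
            ((n + 1 : ℕ) : ℤ) * ((p ^ (a - m).toNat : ℕ) : ℤ) :=
          le_mul_of_one_le_left (by positivity) (by push_cast; omega)
        have := Int.self_le_toNat (a - m)
        omega)
    rwa [mul_assoc] at this
  have hW0 : 0 ≤ W := by
    have : 0 ≤ ∑' n : ℕ, 1 / ((n : ℝ) + 1) ^ 2 := tsum_nonneg fun n => by positivity
    positivity
  have hzero : Real.exp (-(3 * C)) * ‖S.coeff m‖ ≤ 0 := by
    refine le_of_forall_pos_le_add fun ε hε => ?_
    rw [zero_add]
    refine (hle (ε / (W + 1)) (by positivity)).trans ?_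
    rw [div_mul_eq_mul_div, div_le_iff₀ (by positivity)]
    nlinarith
  have : ‖S.coeff m‖ ≤ 0 := by
    have hpos := Real.exp_pos (-(3 * C))
    by_contra! h
    exact absurd hzero (not_le.mpr (mul_pos hpos h))
  exact norm_le_zero_iff.mp this
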